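/- Theorem 3.1 (Initialization). There exist universal constants c, C > 0 such that the following holds. Pick any δ₀ < 0.1. Assume Assumption 1 holds and the measurement matrices A_k are as in the context. If mq ≥ Cκ⁴μ²(n+q)r²/δ₀², then with probability at least 1 − exp(−c(n+q)), SD(U*, U₀) ≤ δ₀, where U₀ is the truncated spectral initialization defined in the context. -/

import Mathlib

open MeasureTheory ProbabilityTheory Matrix
open scoped ENNReal

noncomputable section

/-- Euclidean norm of a finitely-indexed real vector. -/
def vnorm {ι : Type*} [Fintype ι] (v : ι → ℝ) : ℝ := Real.sqrt (∑ i, v i ^ 2)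

/-- Frobenius norm of a real matrix. -/
def frob {ι ι' : Type*} [Fintype ι] [Fintype ι'] (M : Matrix ι ι' ℝ) : ℝ :=
  Real.sqrt (∑ i, ∑ j, M i j ^ 2)

/-- Spectral (ℓ2 operator) norm of a real matrix. -/
def spec {ι ι' : Type*} [Fintype ι] [Fintype ι'] (M : Matrix ι ι' ℝ) : ℝ :=
  sSup {c | ∃ z, vnorm z = 1 ∧ c = vnorm (M.mulVec z)}

/-- Smallest singular value of an r×q matrix with r ≤ q (or of a square matrix):
the minimum of ‖Bᵀw‖ over unit vectors w. -/
def sigMin {ι ι' : Type*} [Fintype ι] [Fintype ι'] (B : Matrix ι ι' ℝ) : ℝ :=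
  sInf {c | ∃ w, vnorm w = 1 ∧ c = vnorm (Bᵀ.mulVec w)}

/-- The k-th column of a matrix. -/
def matCol {ι ι' : Type*} (B : Matrix ι ι' ℝ) (k : ι') : ι → ℝ := fun i => B i k

/-- Subspace distance SD(U₁,U₂) := ‖(I − U₁U₁ᵀ)U₂‖_F. -/
def SD {n r : ℕ} (U₁ U₂ : Matrix (Fin n) (Fin r) ℝ) : ℝ :=
  frob ((1 - U₁ * U₁ᵀ) * U₂)

/-- The standard Gaussian measure on ℝ. -/
def stdGaussian : Measure ℝ := gaussianReal 0 1

instance : IsProbabilityMeasure stdGaussian :=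
  inferInstanceAs (IsProbabilityMeasure (gaussianReal 0 1))

/-- A standard Gaussian random vector in ℝⁿ (i.i.d. N(0,1) coordinates). -/
def gaussianVec (n : ℕ) : Measure (Fin n → ℝ) := Measure.pi fun _ => stdGaussian

instance (n : ℕ) : IsProbabilityMeasure (gaussianVec n) := by
  unfold gaussianVec; infer_instance

/-- i.i.d. standard Gaussian random vectors a_{k i} ∈ ℝⁿ, k ∈ [q], i ∈ [m]. -/
def gaussianMatrices (q m n : ℕ) : Measure (Fin q → Fin m → Fin n → ℝ) :=
  Measure.pi fun _ => Measure.pi fun _ => gaussianVec n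

instance (q m n : ℕ) : IsProbabilityMeasure (gaussianMatrices q m n) := by
  unfold gaussianMatrices; infer_instance

/-- Truncated spectral-initialization matrix X̂₀ = (1/m) Σ_{k,i} a_ki y_ki 1{y_ki² ≤ α} e_kᵀ. -/
def initMat {n q m : ℕ} (xstar : Fin q → Fin n → ℝ) (α : ℝ)
    (ω : Fin q → Fin m → Fin n → ℝ) : Matrix (Fin n) (Fin q) ℝ :=
  Matrix.of fun j k => (1 / (m : ℝ)) * ∑ i, ω k i j * (ω k i ⬝ᵥ xstar k) *
    (if (ω k i ⬝ᵥ xstar k) ^ 2 ≤ α then 1 else 0)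

/-- Data-dependent truncation threshold α := C̃ Σ_{k,i} y_ki² / (mq). -/
def initAlpha {n q m : ℕ} (xstar : Fin q → Fin n → ℝ) (Ctil : ℝ)
    (ω : Fin q → Fin m → Fin n → ℝ) : ℝ :=
  Ctil * ((∑ k, ∑ i, (ω k i ⬝ᵥ xstar k) ^ 2) / ((m : ℝ) * q))

/-- β(α) := E[ζ² 1{‖x‖² ζ² ≤ α}] for ζ standard Gaussian. -/
def betaK (normx α : ℝ) : ℝ :=
  ∫ z, z ^ 2 * (if normx ^ 2 * z ^ 2 ≤ α then 1 else 0) ∂stdGaussian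

/-- The least-squares estimate b̂ := (UᵀAᵀAU)⁻¹ Uᵀ Aᵀ A x. -/
def lsEst {n r m : ℕ} (U : Matrix (Fin n) (Fin r) ℝ) (A : Matrix (Fin m) (Fin n) ℝ)
    (x : Fin n → ℝ) : Fin r → ℝ :=
  ((Uᵀ * Aᵀ * A * U)⁻¹ * Uᵀ * Aᵀ * A).mulVec x

/-- Gradient w.r.t. U of the squared loss: Σ_k Aᵀ(AUb̂_k − Ax*_k)b̂_kᵀ. -/
def gradU {n r q m : ℕ} (U : Matrix (Fin n) (Fin r) ℝ)
    (A : Fin q → Matrix (Fin m) (Fin n) ℝ) (xstar : Fin q → Fin n → ℝ)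
    (bhat : Fin q → Fin r → ℝ) : Matrix (Fin n) (Fin r) ℝ :=
  ∑ k, (A k)ᵀ * vecMulVec ((A k).mulVec (U.mulVec (bhat k) - xstar k)) (bhat k)

/-- `U` has orthonormal columns whose span is the span of eigenvectors of `S`
corresponding to its `r` largest eigenvalues: `S` maps the column span of `U` into itself,
and wᵀSw ≥ zᵀSz for unit w in the span and unit z orthogonal to it. -/
def IsTopREigenBasis {n r : ℕ} (S : Matrix (Fin n) (Fin n) ℝ)
    (U : Matrix (Fin n) (Fin r) ℝ) : Prop :=
  Uᵀ * U = 1 ∧ (∃ M : Matrix (Fin r) (Fin r) ℝ, S * U = U * M) ∧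
  ∀ w z : Fin n → ℝ, (∃ cvec : Fin r → ℝ, w = U.mulVec cvec) → Uᵀ.mulVec z = 0 →
    vnorm w = 1 → vnorm z = 1 → z ⬝ᵥ S.mulVec z ≤ w ⬝ᵥ S.mulVec w

/-- Sample sizes for the 2T+1 sample splits: batch τ ∈ {0,…,T} has m τ rows,
batch τ = T + t (t ∈ {1,…,T}) has m t rows. -/
def msize (m : ℕ → ℕ) (T τ : ℕ) : ℕ := if τ ≤ T then m τ else m (τ - T)

/-- The joint distribution of all 2T+1 independent sample batches of i.i.d. standard
Gaussian measurement vectors. -/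
def splitGauss (m : ℕ → ℕ) (T q n : ℕ) :
    Measure (∀ τ : Fin (2 * T + 1), Fin q → Fin (msize m T τ.1) → Fin n → ℝ) :=
  Measure.pi fun τ => gaussianMatrices q (msize m T τ.1) n

instance (m : ℕ → ℕ) (T q n : ℕ) : IsProbabilityMeasure (splitGauss m T q n) := by
  unfold splitGauss; infer_instance

end

/-- A real symmetric matrix is diagonalized by an orthogonal matrix. -/
lemma exists_orthogonal_diagonalization {r : ℕ} (H : Matrix (Fin r) (Fin r) ℝ) (hH : Hᵀ = H) :
    ∃ (Q : Matrix (Fin r) (Fin r) ℝ) (d : Fin r → ℝ),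
      Qᵀ * Q = 1 ∧ Q * Qᵀ = 1 ∧ ∀ j, H *ᵥ Q.col j = d j • Q.col j := by
  have hh : H.IsHermitian := by
    rw [Matrix.IsHermitian, Matrix.conjTranspose_eq_transpose_of_trivial, hH]
  refine ⟨(hh.eigenvectorUnitary : Matrix (Fin r) (Fin r) ℝ), hh.eigenvalues, ?_, ?_, ?_⟩
  · have := Unitary.coe_star_mul_self hh.eigenvectorUnitary
    rwa [Matrix.star_eq_conjTranspose, Matrix.conjTranspose_eq_transpose_of_trivial] at this
  · have := Unitary.coe_mul_star_self hh.eigenvectorUnitary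
    rwa [Unitary.coe_star, Matrix.star_eq_conjTranspose, Matrix.conjTranspose_eq_transpose_of_trivial] at this
  · intro j
    rw [hh.eigenvectorUnitary_col_eq]
    simpa using hh.mulVec_eigenvectorBasis j

lemma dotProduct_self_nonneg_real {ι : Type*} [Fintype ι] (v : ι → ℝ) : 0 ≤ v ⬝ᵥ v :=
  Finset.sum_nonneg fun i _ => mul_self_nonneg (v i)

lemma dotProduct_self_pos_real {ι : Type*} [Fintype ι] {v : ι → ℝ} (hv : v ≠ 0) : 0 < v ⬝ᵥ v :=
  lt_of_le_of_ne (dotProduct_self_nonneg_real v)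
    fun h => hv (dotProduct_self_eq_zero.mp h.symm)

lemma vnorm_sq {ι : Type*} [Fintype ι] (v : ι → ℝ) : vnorm v ^ 2 = v ⬝ᵥ v := by
  rw [vnorm, Real.sq_sqrt (Finset.sum_nonneg fun i _ => sq_nonneg _), dotProduct]
  exact Finset.sum_congr rfl fun i _ => sq _

lemma vnorm_nonneg {ι : Type*} [Fintype ι] (v : ι → ℝ) : 0 ≤ vnorm v := Real.sqrt_nonneg _

lemma vnorm_eq_sqrt {ι : Type*} [Fintype ι] (v : ι → ℝ) : vnorm v = Real.sqrt (v ⬝ᵥ v) := by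
  rw [← vnorm_sq, Real.sqrt_sq (vnorm_nonneg v)]

lemma vnorm_eq_one {ι : Type*} [Fintype ι] {v : ι → ℝ} (h : v ⬝ᵥ v = 1) : vnorm v = 1 := by
  rw [vnorm_eq_sqrt, h, Real.sqrt_one]

lemma mulVec_dotProduct_mulVec {ι κ : Type*} [Fintype ι] [Fintype κ] (A : Matrix ι κ ℝ)
    (v : ι → ℝ) (w : κ → ℝ) : v ⬝ᵥ (A *ᵥ w) = (Aᵀ *ᵥ v) ⬝ᵥ w := by
  rw [dotProduct_mulVec, ← mulVec_transpose]

lemma frob_sq {ι ι' : Type*} [Fintype ι] [Fintype ι'] (M : Matrix ι ι' ℝ) :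
    frob M ^ 2 = ∑ i, ∑ j, M i j ^ 2 :=
  Real.sq_sqrt (Finset.sum_nonneg fun _ _ => Finset.sum_nonneg fun _ _ => sq_nonneg _)

/-- An orthogonal projection does not increase the Euclidean norm. -/
lemma proj_dotProduct_le {n r : ℕ} {U : Matrix (Fin n) (Fin r) ℝ} (hU : Uᵀ * U = 1)
    (v : Fin n → ℝ) :
    ((1 - U * Uᵀ) *ᵥ v) ⬝ᵥ ((1 - U * Uᵀ) *ᵥ v) ≤ v ⬝ᵥ v := by
  have h1 : (1 - U * Uᵀ)ᵀ * (1 - U * Uᵀ) = 1 - U * Uᵀ := by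
    have : U * Uᵀ * (U * Uᵀ) = U * Uᵀ := by
      rw [Matrix.mul_assoc, ← Matrix.mul_assoc Uᵀ, hU, Matrix.one_mul]
    simp [Matrix.transpose_sub, Matrix.transpose_mul, sub_mul, mul_sub, this]
  rw [mulVec_dotProduct_mulVec, mulVec_mulVec, h1, sub_mulVec, one_mulVec, sub_dotProduct,
    ← mulVec_mulVec, dotProduct_comm (U *ᵥ _), mulVec_dotProduct_mulVec]
  linarith [dotProduct_self_nonneg_real (Uᵀ *ᵥ v)]

/-- If a quadratic form `XXᵀ` is at least `s` on some `r`-dimensional subspace, then all its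
eigenvalues along a top-`r` eigenbasis are at least `s`. -/
lemma eigenvalue_ge_of_topR {n r : ℕ} {S : Matrix (Fin n) (Fin n) ℝ}
    {U Us G : Matrix (Fin n) (Fin r) ℝ} {Q : Matrix (Fin r) (Fin r) ℝ} {d : Fin r → ℝ} {s : ℝ}
    (hS : Sᵀ = S) (hQ' : Q * Qᵀ = 1) (hG : G = U * Q) (hGG : Gᵀ * G = 1)
    (hSG : ∀ j, S *ᵥ G.col j = d j • G.col j)
    (hUs : Usᵀ * Us = 1)
    (htop : ∀ w z : Fin n → ℝ, (∃ cvec : Fin r → ℝ, w = U.mulVec cvec) → Uᵀ.mulVec z = 0 →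
      vnorm w = 1 → vnorm z = 1 → z ⬝ᵥ S.mulVec z ≤ w ⬝ᵥ S.mulVec w)
    (hs : ∀ c : Fin r → ℝ, s * (c ⬝ᵥ c) ≤ (Us *ᵥ c) ⬝ᵥ (S *ᵥ (Us *ᵥ c))) (j : Fin r) :
    s ≤ d j := by
  have hgg : ∀ i l, G.col i ⬝ᵥ G.col l = if i = l then 1 else 0 := by
    intro i l
    have := congrFun (congrFun hGG i) l
    rw [Matrix.mul_apply, Matrix.one_apply] at this
    simpa [dotProduct, Matrix.col_apply] using this
  obtain ⟨c, hc, hAc⟩ : ∃ c : Fin r → ℝ, c ≠ 0 ∧ ∀ i, i ≠ j → (Gᵀ *ᵥ (Us *ᵥ c)) i = 0 := by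
    by_cases hdet : (Gᵀ * Us).det = 0
    · obtain ⟨c, hc, h⟩ := Matrix.exists_mulVec_eq_zero_iff.mpr hdet
      exact ⟨c, hc, fun i _ => by rw [mulVec_mulVec, h]; rfl⟩
    · have hu : IsUnit (Gᵀ * Us).det := isUnit_iff_ne_zero.mpr hdet
      have key : (Gᵀ * Us) *ᵥ ((Gᵀ * Us)⁻¹ *ᵥ Pi.single j 1) = Pi.single j 1 := by
        rw [mulVec_mulVec, Matrix.mul_nonsing_inv _ hu, one_mulVec]
      refine ⟨(Gᵀ * Us)⁻¹ *ᵥ Pi.single j 1, ?_, ?_⟩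
      · intro h
        rw [h, mulVec_zero] at key
        have := congrFun key j
        simp at this
      · intro i hi
        rw [mulVec_mulVec, key]
        simp [hi]
  set v := Us *ᵥ c with hv
  set g := G.col j with hg
  set a := (Gᵀ *ᵥ v) j with ha
  have hag : g ⬝ᵥ v = a := rfl
  set z := v - a • g with hz
  have hgz : g ⬝ᵥ z = 0 := by
    rw [hz, dotProduct_sub, dotProduct_smul, hag, hgg]; simp
  have hGz : Gᵀ *ᵥ z = 0 := by
    ext i
    by_cases hi : i = j
    · subst hi; exact hgz
    · have h1 : G.col i ⬝ᵥ v = 0 := hAc i hi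
      change G.col i ⬝ᵥ z = 0
      rw [hz, dotProduct_sub, dotProduct_smul, h1, hgg]; simp [hi]
  have hUz : Uᵀ *ᵥ z = 0 := by
    have : Q *ᵥ (Gᵀ *ᵥ z) = Uᵀ *ᵥ z := by
      rw [hG, transpose_mul, mulVec_mulVec, ← Matrix.mul_assoc, hQ', Matrix.one_mul]
    rw [← this, hGz, mulVec_zero]
  have hvv : v ⬝ᵥ v = c ⬝ᵥ c := by
    rw [hv, mulVec_dotProduct_mulVec, mulVec_mulVec, hUs, one_mulVec]
  have hgSg : g ⬝ᵥ (S *ᵥ g) = d j := by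
    rw [hg, hSG, dotProduct_smul, hgg]; simp
  have hzS : z ⬝ᵥ (S *ᵥ z) ≤ d j * (z ⬝ᵥ z) := by
    by_cases hz0 : z = 0
    · simp [hz0]
    have hpos := dotProduct_self_pos_real hz0
    set t := (Real.sqrt (z ⬝ᵥ z))⁻¹ with ht
    have htt : t * t * (z ⬝ᵥ z) = 1 := by
      rw [ht, ← mul_inv, Real.mul_self_sqrt hpos.le, inv_mul_cancel₀ hpos.ne']
    have h := htop g (t • z) ⟨Q.col j, by ext i; rw [hg, hG]; rfl⟩
      (by rw [mulVec_smul, hUz, smul_zero]) (vnorm_eq_one (by rw [hg, hgg]; simp))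
      (vnorm_eq_one (by
        rw [smul_dotProduct, dotProduct_smul, smul_eq_mul, smul_eq_mul, ← mul_assoc, htt]))
    change _ ≤ g ⬝ᵥ (S *ᵥ g) at h
    rw [hgSg, mulVec_smul, smul_dotProduct, dotProduct_smul, smul_eq_mul, smul_eq_mul,
      ← mul_assoc] at h
    have h2 := mul_le_mul_of_nonneg_right h hpos.le
    calc z ⬝ᵥ (S *ᵥ z) = (t * t * (z ⬝ᵥ z)) * (z ⬝ᵥ (S *ᵥ z)) := by rw [htt, one_mul]
      _ = t * t * (z ⬝ᵥ S *ᵥ z) * (z ⬝ᵥ z) := by ring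
      _ ≤ _ := h2
  have hvz : v = a • g + z := by rw [hz]; abel
  have hzg : z ⬝ᵥ g = 0 := by rw [dotProduct_comm, hgz]
  have hgSz : g ⬝ᵥ (S *ᵥ z) = 0 := by
    rw [mulVec_dotProduct_mulVec, hS, hg, hSG, smul_dotProduct, hgz, smul_zero]
  have hzSg : z ⬝ᵥ (S *ᵥ g) = 0 := by
    rw [hg, hSG, dotProduct_smul, ← hg, hzg, smul_zero]
  have e1 : v ⬝ᵥ (S *ᵥ v) = a * a * d j + z ⬝ᵥ (S *ᵥ z) := by
    rw [hvz, mulVec_add, mulVec_smul]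
    simp only [add_dotProduct, dotProduct_add, smul_dotProduct, dotProduct_smul, smul_eq_mul,
      hgSz, hzSg, hgSg]
    ring
  have e2 : v ⬝ᵥ v = a * a + z ⬝ᵥ z := by
    have : g ⬝ᵥ g = 1 := by rw [hg, hgg]; simp
    rw [hvz]
    simp only [add_dotProduct, dotProduct_add, smul_dotProduct, dotProduct_smul, smul_eq_mul,
      hgz, hzg, this]
    ring
  have h3 : s * (v ⬝ᵥ v) ≤ d j * (v ⬝ᵥ v) := by
    have := hs c
    rw [← hv, e1, ← hvv, e2] at this
    rw [e2]
    linarith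
  have : 0 < v ⬝ᵥ v := by rw [hvv]; exact dotProduct_self_pos_real hc
  exact le_of_mul_le_mul_right h3 this

/-- A sin-theta bound: if `XXᵀ` is at least `s` on the span of `Us` and the part of `X` orthogonal
to that span has squared operator norm at most `τ`, then a top-`r` eigenbasis of `XXᵀ` is at squared
subspace distance at most `r * τ / s` from `Us`. -/
lemma SD_sq_le_of_topR {n q r : ℕ} {X : Matrix (Fin n) (Fin q) ℝ}
    {U Us : Matrix (Fin n) (Fin r) ℝ} {s τ : ℝ}
    (hs0 : 0 < s) (hUs : Usᵀ * Us = 1) (htop : IsTopREigenBasis (X * Xᵀ) U)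
    (hs : ∀ c : Fin r → ℝ, s * (c ⬝ᵥ c) ≤ (Xᵀ *ᵥ (Us *ᵥ c)) ⬝ᵥ (Xᵀ *ᵥ (Us *ᵥ c)))
    (hN : ∀ z : Fin q → ℝ, ((1 - Us * Usᵀ) *ᵥ (X *ᵥ z)) ⬝ᵥ ((1 - Us * Usᵀ) *ᵥ (X *ᵥ z)) ≤
      τ * (z ⬝ᵥ z)) :
    SD Us U ^ 2 ≤ r * τ / s := by
  obtain ⟨hU, ⟨M, hM⟩, htop⟩ := htop
  set S := X * Xᵀ with hSdef
  have hS : Sᵀ = S := by rw [hSdef, transpose_mul, transpose_transpose]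
  have hM' : M = Uᵀ * S * U := by
    rw [Matrix.mul_assoc, hM, ← Matrix.mul_assoc, hU, Matrix.one_mul]
  obtain ⟨Q, d, hQ, hQ', hd⟩ := exists_orthogonal_diagonalization M (by
    rw [hM']; simp only [transpose_mul, transpose_transpose, hS, Matrix.mul_assoc])
  set G := U * Q with hG
  have hGG : Gᵀ * G = 1 := by
    rw [hG, transpose_mul, Matrix.mul_assoc, ← Matrix.mul_assoc Uᵀ, hU, Matrix.one_mul, hQ]
  have hcol : ∀ j, G.col j = U *ᵥ Q.col j := fun j => by ext i; rfl
  have hSG : ∀ j, S *ᵥ G.col j = d j • G.col j := by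
    intro j
    rw [hcol, mulVec_mulVec, hM, ← mulVec_mulVec, hd, mulVec_smul]
  have hSX : ∀ v w, v ⬝ᵥ (S *ᵥ w) = (Xᵀ *ᵥ v) ⬝ᵥ (Xᵀ *ᵥ w) := by
    intro v w
    rw [hSdef, ← mulVec_mulVec, mulVec_dotProduct_mulVec]
  have hds : ∀ j, s ≤ d j := fun j =>
    eigenvalue_ge_of_topR hS hQ' hG hGG hSG hUs htop (fun c => by rw [hSX]; exact hs c) j
  set P := 1 - Us * Usᵀ with hP
  have hfro : SD Us U ^ 2 = ∑ j, (P *ᵥ G.col j) ⬝ᵥ (P *ᵥ G.col j) := by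
    have h1 : ∀ B : Matrix (Fin n) (Fin r) ℝ, ∑ i, ∑ j, B i j ^ 2 = (Bᵀ * B).trace := by
      intro B
      rw [Finset.sum_comm, Matrix.trace]
      refine Finset.sum_congr rfl fun j _ => ?_
      rw [Matrix.diag_apply, Matrix.mul_apply]
      exact Finset.sum_congr rfl fun i _ => sq _
    have h2 : ∑ j, (P *ᵥ G.col j) ⬝ᵥ (P *ᵥ G.col j) = ∑ i, ∑ j, (P * G) i j ^ 2 := by
      rw [Finset.sum_comm]
      refine Finset.sum_congr rfl fun j _ => Finset.sum_congr rfl fun i _ => ?_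
      rw [sq]; rfl
    have h3 : ((P * G)ᵀ * (P * G)).trace = ((P * U)ᵀ * (P * U)).trace := by
      rw [hG, ← Matrix.mul_assoc P, transpose_mul (P * U) Q, Matrix.mul_assoc, Matrix.trace_mul_comm,
        Matrix.mul_assoc, Matrix.mul_assoc, hQ', Matrix.mul_one]
    rw [SD, frob_sq, h2, h1, h1, h3]
  have hj : ∀ j, (P *ᵥ G.col j) ⬝ᵥ (P *ᵥ G.col j) ≤ τ / s := by
    intro j
    have hdj : 0 < d j := hs0.trans_le (hds j)
    have hgg : G.col j ⬝ᵥ G.col j = 1 := by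
      have := congrFun (congrFun hGG j) j
      rw [Matrix.mul_apply, Matrix.one_apply] at this
      simpa [dotProduct, Matrix.col_apply] using this
    have h1 := hN (Xᵀ *ᵥ G.col j)
    rw [← hSX, mulVec_mulVec (M := X), ← hSdef, hSG, dotProduct_smul, hgg, mulVec_smul,
      smul_dotProduct, dotProduct_smul] at h1
    simp only [smul_eq_mul, mul_one] at h1
    have h2 : d j * ((P *ᵥ G.col j) ⬝ᵥ (P *ᵥ G.col j)) ≤ τ := by
      have : d j * (d j * ((P *ᵥ G.col j) ⬝ᵥ (P *ᵥ G.col j))) ≤ d j * τ := by linarith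
      exact le_of_mul_le_mul_left this hdj
    rw [le_div_iff₀ hs0]
    have h3 := mul_le_mul_of_nonneg_right (hds j) (dotProduct_self_nonneg_real (P *ᵥ G.col j))
    linarith
  rw [hfro]
  calc _ ≤ ∑ _j : Fin r, τ / s := Finset.sum_le_sum fun j _ => hj j
    _ = r * τ / s := by simp [mul_div_assoc]

lemma vnorm_smul {ι : Type*} [Fintype ι] (t : ℝ) (v : ι → ℝ) : vnorm (t • v) = |t| * vnorm v := by
  rw [vnorm_eq_sqrt, vnorm_eq_sqrt, smul_dotProduct, dotProduct_smul, smul_eq_mul, smul_eq_mul,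
    ← mul_assoc, Real.sqrt_mul (mul_self_nonneg t), Real.sqrt_mul_self_eq_abs]

lemma vnorm_pos {ι : Type*} [Fintype ι] {v : ι → ℝ} (hv : v ≠ 0) : 0 < vnorm v := by
  rw [vnorm_eq_sqrt]; exact Real.sqrt_pos.mpr (dotProduct_self_pos_real hv)

lemma vnorm_normalize {ι : Type*} [Fintype ι] {v : ι → ℝ} (hv : v ≠ 0) :
    vnorm ((vnorm v)⁻¹ • v) = 1 := by
  rw [vnorm_smul, abs_of_nonneg (inv_nonneg.mpr (vnorm_nonneg v)),
    inv_mul_cancel₀ (vnorm_pos hv).ne']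

lemma dotProduct_le_vnorm_mul_vnorm {ι : Type*} [Fintype ι] (v w : ι → ℝ) :
    v ⬝ᵥ w ≤ vnorm v * vnorm w := by
  rw [dotProduct, vnorm, vnorm]
  exact Real.sum_mul_le_sqrt_mul_sqrt _ _ _

lemma continuous_vnorm {ι : Type*} [Fintype ι] : Continuous (vnorm : (ι → ℝ) → ℝ) := by
  unfold vnorm; fun_prop

lemma vnorm_mulVec_le_frob {ι κ : Type*} [Fintype ι] [Fintype κ] (M : Matrix ι κ ℝ) (z : κ → ℝ) :
    vnorm (M *ᵥ z) ≤ frob M * vnorm z := by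
  have hf : 0 ≤ frob M := Real.sqrt_nonneg _
  refine abs_le_of_sq_le_sq' ?_ (mul_nonneg hf (vnorm_nonneg z)) |>.2
  rw [mul_pow, frob_sq, vnorm_sq, Finset.sum_mul]
  refine Finset.sum_le_sum fun i _ => ?_
  have h : (M i ⬝ᵥ z) ^ 2 ≤ (∑ j, M i j ^ 2) * ∑ j, z j ^ 2 := Finset.sum_mul_sq_le_sq_mul_sq _ _ _
  have hz : z ⬝ᵥ z = ∑ j, z j ^ 2 := Finset.sum_congr rfl fun j _ => (sq _).symm
  rw [vnorm_sq, ← sq, hz]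
  exact h

lemma isCompact_vnorm_sphere {ι : Type*} [Fintype ι] :
    IsCompact {w : ι → ℝ | vnorm w = 1} := by
  refine Metric.isCompact_of_isClosed_isBounded (isClosed_eq continuous_vnorm continuous_const) ?_
  refine (Metric.isBounded_closedBall (x := (0 : ι → ℝ)) (r := 1)).subset fun w hw => ?_
  rw [mem_closedBall_zero_iff, pi_norm_le_iff_of_nonneg zero_le_one]
  intro i
  have h1 : ∑ j, w j ^ 2 = 1 := by
    have := vnorm_sq w
    rw [show vnorm w = 1 from hw, dotProduct] at this
    simp only [sq] at this ⊢
    linarith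
  have h2 : w i ^ 2 ≤ 1 :=
    h1 ▸ Finset.single_le_sum (f := fun j => w j ^ 2) (fun j _ => sq_nonneg _) (Finset.mem_univ i)
  rw [Real.norm_eq_abs]
  exact (sq_le_one_iff_abs_le_one _).mp h2

lemma sigMin_mul_vnorm_le {r q : ℕ} (B : Matrix (Fin r) (Fin q) ℝ) (w : Fin r → ℝ) :
    sigMin B * vnorm w ≤ vnorm (Bᵀ *ᵥ w) := by
  by_cases hw : w = 0
  · simp [hw, vnorm]
  have h : sigMin B ≤ vnorm (Bᵀ *ᵥ ((vnorm w)⁻¹ • w)) :=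
    csInf_le ⟨0, by rintro _ ⟨w, -, rfl⟩; exact vnorm_nonneg _⟩ ⟨_, vnorm_normalize hw, rfl⟩
  rw [mulVec_smul, vnorm_smul, abs_of_nonneg (inv_nonneg.mpr (vnorm_nonneg w)),
    inv_mul_eq_div, le_div_iff₀ (vnorm_pos hw)] at h
  exact h

lemma sigMin_pos {r q : ℕ} (hr : 0 < r) {B : Matrix (Fin r) (Fin q) ℝ} (hB : B.rank = r) :
    0 < sigMin B := by
  have hli : LinearIndependent ℝ B.row := by
    rw [linearIndependent_iff_card_eq_finrank_span, Set.finrank, ← Matrix.rank_eq_finrank_span_row,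
      hB, Fintype.card_fin]
  have hinj : Function.Injective (Bᵀ *ᵥ ·) := by
    have := Matrix.vecMul_injective_iff.mpr hli
    intro a b hab
    exact this (by simpa [mulVec_transpose] using hab)
  have hne : {w : Fin r → ℝ | vnorm w = 1}.Nonempty := by
    refine ⟨Pi.single ⟨0, hr⟩ 1, vnorm_eq_one ?_⟩
    simp
  have hcont : Continuous fun w : Fin r → ℝ => vnorm (Bᵀ *ᵥ w) :=
    continuous_vnorm.comp (Continuous.matrix_mulVec continuous_const continuous_id)
  obtain ⟨w, hw, hmin⟩ := isCompact_vnorm_sphere.exists_isMinOn hne hcont.continuousOn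
  have hw0 : w ≠ 0 := by
    rintro rfl
    have : vnorm (0 : Fin r → ℝ) = 1 := hw
    simp [vnorm] at this
  have hpos : 0 < vnorm (Bᵀ *ᵥ w) := by
    refine vnorm_pos fun h => hw0 (hinj ?_)
    simpa using h
  refine hpos.trans_le (le_csInf ⟨_, w, hw, rfl⟩ ?_)
  rintro _ ⟨v, hv, rfl⟩
  exact hmin hv

lemma spec_nonneg {n q : ℕ} (X : Matrix (Fin n) (Fin q) ℝ) : 0 ≤ spec X :=
  Real.sSup_nonneg (by rintro _ ⟨_, -, rfl⟩; exact vnorm_nonneg _)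

lemma vnorm_mulVec_le_spec {n q : ℕ} (X : Matrix (Fin n) (Fin q) ℝ) (z : Fin q → ℝ) :
    vnorm (X *ᵥ z) ≤ spec X * vnorm z := by
  by_cases hz : z = 0
  · simp [hz, vnorm]
  have h : vnorm (X *ᵥ ((vnorm z)⁻¹ • z)) ≤ spec X := by
    refine le_csSup ⟨frob X, ?_⟩ ⟨_, vnorm_normalize hz, rfl⟩
    rintro _ ⟨v, hv, rfl⟩
    simpa [hv] using vnorm_mulVec_le_frob X v
  rw [mulVec_smul, vnorm_smul, abs_of_nonneg (inv_nonneg.mpr (vnorm_nonneg z)),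
    inv_mul_eq_div, div_le_iff₀ (vnorm_pos hz)] at h
  exact h

/-- A bound on `‖N z‖` transfers to the transpose. -/
lemma vnorm_transpose_mulVec_le {n q : ℕ} {N : Matrix (Fin n) (Fin q) ℝ} {t : ℝ}
    (ht : 0 ≤ t) (h : ∀ z, vnorm (N *ᵥ z) ≤ t * vnorm z) (w : Fin n → ℝ) :
    vnorm (Nᵀ *ᵥ w) ≤ t * vnorm w := by
  by_cases h0 : Nᵀ *ᵥ w = 0
  · have h1 : vnorm (0 : Fin q → ℝ) = 0 := by simp [vnorm]
    rw [h0, h1]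
    exact mul_nonneg ht (vnorm_nonneg w)
  have hp := vnorm_pos h0
  have h1 : vnorm (Nᵀ *ᵥ w) ^ 2 ≤ vnorm w * (t * vnorm (Nᵀ *ᵥ w)) := by
    rw [vnorm_sq, ← mulVec_dotProduct_mulVec]
    exact (dotProduct_le_vnorm_mul_vnorm _ _).trans
      (mul_le_mul_of_nonneg_left (h _) (vnorm_nonneg w))
  have : vnorm (Nᵀ *ᵥ w) * vnorm (Nᵀ *ᵥ w) ≤ (t * vnorm w) * vnorm (Nᵀ *ᵥ w) := by linarith
  exact le_of_mul_le_mul_right this hp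

lemma vnorm_orthonormal_mulVec {n r : ℕ} {U : Matrix (Fin n) (Fin r) ℝ} (hU : Uᵀ * U = 1)
    (c : Fin r → ℝ) : vnorm (U *ᵥ c) = vnorm c := by
  rw [vnorm_eq_sqrt, mulVec_dotProduct_mulVec, mulVec_mulVec, hU, one_mulVec, ← vnorm_eq_sqrt]

lemma vnorm_transpose_mulVec_le_spec {n r q : ℕ} {U : Matrix (Fin n) (Fin r) ℝ}
    (hU : Uᵀ * U = 1) (B : Matrix (Fin r) (Fin q) ℝ) (w : Fin r → ℝ) :
    vnorm (Bᵀ *ᵥ w) ≤ spec (U * B) * vnorm w := by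
  refine vnorm_transpose_mulVec_le (spec_nonneg _) (fun z => ?_) w
  rw [← vnorm_orthonormal_mulVec hU, mulVec_mulVec]
  exact vnorm_mulVec_le_spec _ z

lemma lintegral_pi_prod {ι : Type*} [Fintype ι] {α : ι → Type*} [∀ i, MeasurableSpace (α i)]
    (μ : ∀ i, Measure (α i)) [∀ i, IsProbabilityMeasure (μ i)] {f : ∀ i, α i → ℝ≥0∞}
    (hf : ∀ i, Measurable (f i)) :
    ∫⁻ x, ∏ i, f i (x i) ∂(Measure.pi μ) = ∏ i, ∫⁻ x, f i x ∂(μ i) := by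
  have hind : iIndepFun (fun i (x : ∀ i, α i) => f i (x i)) (Measure.pi μ) :=
    iIndepFun_pi fun i => (hf i).aemeasurable
  rw [lintegral_prod_eq_prod_lintegral_of_indepFun Finset.univ
    (fun i (x : ∀ i, α i) => f i (x i)) hind fun i => (hf i).comp (measurable_pi_apply i)]
  refine Finset.prod_congr rfl fun i _ => ?_
  exact (measurePreserving_eval μ i).lintegral_comp (hf i)

/-- Coordinatewise measure preserving maps out of a product assemble to a measure preserving map
out of the product of the two product measures. -/
lemma measurePreserving_pi_prod {ι : Type*} [Fintype ι] {α β γ : ι → Type*}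
    [∀ i, MeasurableSpace (α i)] [∀ i, MeasurableSpace (β i)] [∀ i, MeasurableSpace (γ i)]
    (μ : ∀ i, Measure (α i)) (ν : ∀ i, Measure (β i)) (ρ : ∀ i, Measure (γ i))
    [∀ i, IsProbabilityMeasure (μ i)] [∀ i, IsProbabilityMeasure (ν i)]
    [∀ i, IsProbabilityMeasure (ρ i)]
    {T : ∀ i, α i × β i → γ i} (hT : ∀ i, MeasurePreserving (T i) ((μ i).prod (ν i)) (ρ i)) :
    MeasurePreserving (fun (p : (∀ i, α i) × (∀ i, β i)) i => T i (p.1 i, p.2 i))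
      ((Measure.pi μ).prod (Measure.pi ν)) (Measure.pi ρ) := by
  have hm : Measurable fun (p : (∀ i, α i) × (∀ i, β i)) i => (p.1 i, p.2 i) := by fun_prop
  have h1 : MeasurePreserving (fun (p : (∀ i, α i) × (∀ i, β i)) i => (p.1 i, p.2 i))
      ((Measure.pi μ).prod (Measure.pi ν)) (Measure.pi fun i => (μ i).prod (ν i)) := by
    refine ⟨hm, (Measure.pi_eq_generateFrom (fun i => generateFrom_prod)
      (fun i => isPiSystem_prod)
      (fun i => (μ i).toFiniteSpanningSetsIn.prod (ν i).toFiniteSpanningSetsIn) ?_).symm⟩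
    intro s hs
    choose a ha b hb hab using hs
    have hab' : s = fun i => a i ×ˢ b i := funext fun i => (hab i).symm
    have hms : MeasurableSet (Set.univ.pi s) := by
      rw [hab']
      exact MeasurableSet.univ_pi fun i => (ha i).prod (hb i)
    rw [Measure.map_apply hm hms]
    have hpre : (fun (p : (∀ i, α i) × (∀ i, β i)) i => (p.1 i, p.2 i)) ⁻¹' (Set.univ.pi s) =
        (Set.univ.pi a) ×ˢ (Set.univ.pi b) := by
      ext p
      simp [hab', Set.mem_pi, forall_and]
    rw [hpre, Measure.prod_prod, Measure.pi_pi, Measure.pi_pi, ← Finset.prod_mul_distrib, hab']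
    simp_rw [Measure.prod_prod]
  exact (measurePreserving_pi _ _ hT).comp h1

lemma charFunDual_stdGaussian_real (L : StrongDual ℝ ℝ) :
    charFunDual stdGaussian L = Complex.exp (-((L 1 : ℝ) : ℂ) ^ 2 / 2) := by
  have h : charFunDual stdGaussian L = charFun (gaussianReal 0 1) (L 1) := by
    rw [charFunDual_apply, charFun_apply_real, _root_.stdGaussian]
    congr 1
    ext x
    have : L x = L 1 * x := by
      rw [mul_comm, ← smul_eq_mul, ← map_smul, smul_eq_mul, mul_one]
    rw [this]
    push_cast
    rfl
  rw [h, charFun_gaussianReal]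
  congr 1
  push_cast
  ring_nf

lemma charFunDual_gaussianVec {n : ℕ} (L : StrongDual ℝ (Fin n → ℝ)) :
    charFunDual (gaussianVec n) L =
      Complex.exp (-(((∑ j, L (Pi.single j 1) ^ 2 : ℝ)) : ℂ) / 2) := by
  rw [gaussianVec, charFunDual_pi]
  simp_rw [charFunDual_stdGaussian_real]
  rw [← Complex.exp_sum]
  congr 1
  push_cast
  rw [← Finset.sum_div, Finset.sum_neg_distrib]
  rfl

/-- Replacing the component of a standard Gaussian vector along a unit vector by an independent
standard Gaussian variable leaves its law unchanged. -/
lemma measurePreserving_gaussian_split {n : ℕ} {u : Fin n → ℝ} (hu : u ⬝ᵥ u = 1) :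
    MeasurePreserving (fun p : ℝ × (Fin n → ℝ) => p.1 • u + (p.2 - (u ⬝ᵥ p.2) • u))
      (stdGaussian.prod (gaussianVec n)) (gaussianVec n) := by
  have hlin : ∃ T : ℝ × (Fin n → ℝ) →L[ℝ] (Fin n → ℝ),
      ∀ p, T p = p.1 • u + (p.2 - (u ⬝ᵥ p.2) • u) := by
    refine ⟨LinearMap.toContinuousLinearMap
      { toFun := fun p => p.1 • u + (p.2 - (u ⬝ᵥ p.2) • u)
        map_add' := fun p p' => ?_
        map_smul' := fun c p => ?_ }, fun p => rfl⟩
    · simp only [Prod.fst_add, Prod.snd_add, dotProduct_add, add_smul]; abel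
    · simp only [Prod.smul_fst, Prod.smul_snd, dotProduct_smul, smul_eq_mul, RingHom.id_apply,
        smul_add, smul_sub, smul_smul]
  obtain ⟨T, hT⟩ := hlin
  have hT' : (fun p : ℝ × (Fin n → ℝ) => p.1 • u + (p.2 - (u ⬝ᵥ p.2) • u)) = T :=
    funext fun p => (hT p).symm
  rw [hT']
  refine ⟨T.continuous.measurable, ?_⟩
  have : IsProbabilityMeasure ((stdGaussian.prod (gaussianVec n)).map T) :=
    Measure.isProbabilityMeasure_map T.continuous.measurable.aemeasurable
  refine Measure.ext_of_charFunDual (funext fun L => ?_)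
  rw [charFunDual_map, charFunDual_prod, charFunDual_stdGaussian_real, charFunDual_gaussianVec,
    charFunDual_gaussianVec, ← Complex.exp_add]
  congr 1
  set b : Fin n → ℝ := fun j => L (Pi.single j 1) with hb
  have hL : ∀ v : Fin n → ℝ, L v = v ⬝ᵥ b := by
    intro v
    conv_lhs => rw [pi_eq_sum_univ' v]
    rw [map_sum]
    refine Finset.sum_congr rfl fun j _ => ?_
    rw [map_smul, smul_eq_mul, hb]
  have e1 : ((L.comp T).comp (.inl ℝ ℝ (Fin n → ℝ))) 1 = u ⬝ᵥ b := by
    simp [hT, hL]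
  have e2 : ∀ j, ((L.comp T).comp (.inr ℝ ℝ (Fin n → ℝ))) (Pi.single j 1) =
      b j - u j * (u ⬝ᵥ b) := by
    intro j
    simp [hT, hL, sub_dotProduct, smul_dotProduct]
  rw [e1]
  simp_rw [e2]
  have e3 : ∑ j, (b j - u j * (u ⬝ᵥ b)) ^ 2 = ∑ j, b j ^ 2 - (u ⬝ᵥ b) ^ 2 := by
    have : ∀ j, (b j - u j * (u ⬝ᵥ b)) ^ 2 =
        b j ^ 2 - 2 * (u ⬝ᵥ b) * (u j * b j) + (u ⬝ᵥ b) ^ 2 * (u j * u j) := fun j => by ring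
    simp_rw [this]
    rw [Finset.sum_add_distrib, Finset.sum_sub_distrib, ← Finset.mul_sum, ← Finset.mul_sum]
    change _ - 2 * (u ⬝ᵥ b) * (u ⬝ᵥ b) + (u ⬝ᵥ b) ^ 2 * (u ⬝ᵥ u) = _
    rw [hu]; ring
  have e4 : ∑ j, L (Pi.single j 1) ^ 2 = ∑ j, b j ^ 2 := rfl
  rw [e3, e4]
  push_cast
  ring

lemma lintegral_exp_mul_stdGaussian (t : ℝ) :
    ∫⁻ z, ENNReal.ofReal (Real.exp (t * z)) ∂stdGaussian = ENNReal.ofReal (Real.exp (t ^ 2 / 2)) := by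
  rw [_root_.stdGaussian, ← ofReal_integral_eq_lintegral_ofReal (integrable_exp_mul_gaussianReal t)
    (ae_of_all _ fun _ => (Real.exp_pos _).le)]
  have h := mgf_gaussianReal (p := gaussianReal 0 1) (X := id) (μ := 0) (v := 1) (by simp) t
  rw [mgf] at h
  simp only [id] at h
  rw [h]
  simp

lemma lintegral_exp_mul_sq_stdGaussian_le {u : ℝ} (hu0 : 0 ≤ u) (hu : u ≤ 1 / 4) :
    ∫⁻ z, ENNReal.ofReal (Real.exp (u * z ^ 2)) ∂stdGaussian ≤
      ENNReal.ofReal (Real.exp (2 * u)) := by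
  have hb : 0 < 1 / 2 - u := by linarith
  rw [_root_.stdGaussian, gaussianReal_of_var_ne_zero _ one_ne_zero,
    lintegral_withDensity_eq_lintegral_mul _ (measurable_gaussianPDF 0 1) (by fun_prop)]
  have h1 : ∀ z : ℝ, (gaussianPDF 0 1 * fun z => ENNReal.ofReal (Real.exp (u * z ^ 2))) z =
      ENNReal.ofReal ((Real.sqrt (2 * Real.pi))⁻¹ * Real.exp (-(1 / 2 - u) * z ^ 2)) := by
    intro z
    rw [Pi.mul_apply, gaussianPDF, ← ENNReal.ofReal_mul (gaussianPDFReal_nonneg _ _ _),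
      gaussianPDFReal, mul_assoc, ← Real.exp_add]
    congr 3
    · simp
    · simp; ring_nf
  simp_rw [h1]
  rw [← ofReal_integral_eq_lintegral_ofReal ((integrable_exp_neg_mul_sq hb).const_mul _)
    (ae_of_all _ fun _ => by positivity), integral_const_mul, integral_gaussian]
  refine ENNReal.ofReal_le_ofReal ?_
  rw [← Real.sqrt_inv, ← Real.sqrt_mul (by positivity)]
  refine Real.sqrt_le_iff.mpr ⟨(Real.exp_pos _).le, ?_⟩
  rw [← Real.exp_nat_mul]
  have h2 : (2 * Real.pi)⁻¹ * (Real.pi / (1 / 2 - u)) = (1 - 2 * u)⁻¹ := by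
    have : (1 - 2 * u) ≠ 0 := by linarith
    have : (1 / 2 - u) ≠ 0 := hb.ne'
    field_simp
  rw [h2]
  have h3 : 1 + 4 * u ≤ Real.exp (((2 : ℕ) : ℝ) * (2 * u)) := by
    have := Real.add_one_le_exp (((2 : ℕ) : ℝ) * (2 * u))
    push_cast at this ⊢
    linarith
  refine le_trans ?_ h3
  rw [inv_le_iff_one_le_mul₀ (by linarith)]
  nlinarith

/-- A nonnegative function that is positive on a set of positive measure has `𝔼 exp (-h) < 1`. -/
lemma exists_lintegral_exp_neg_le {h : ℝ → ℝ} (hm : Measurable h) (h0 : ∀ z, 0 ≤ h z)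
    {τ : ℝ} (hτ : 0 < τ) (hpos : ∀ z ∈ Set.Ioo 0 τ, 0 < h z) :
    ∃ c : ℝ, 0 < c ∧ ∫⁻ z, ENNReal.ofReal (Real.exp (-h z)) ∂stdGaussian ≤
      ENNReal.ofReal (Real.exp (-(2 * c))) := by
  have hle : ∀ z, ENNReal.ofReal (Real.exp (-h z)) ≤ 1 := fun z =>
    ENNReal.ofReal_le_one.mpr (Real.exp_le_one_iff.mpr (by linarith [h0 z]))
  have hlt : ∫⁻ z, ENNReal.ofReal (Real.exp (-h z)) ∂stdGaussian < 1 := by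
    have : ∫⁻ z, ENNReal.ofReal (Real.exp (-h z)) ∂stdGaussian < ∫⁻ _, 1 ∂stdGaussian := by
      refine lintegral_strict_mono_of_ae_le_of_ae_lt_on (s := Set.Ioo 0 τ) (by fun_prop)
        ?_ (ae_of_all _ hle) ?_ (ae_of_all _ fun z hz => ?_)
      · refine ((lintegral_mono hle).trans_lt ?_).ne
        simp
      · intro h0
        have := gaussianReal_absolutelyContinuous' 0 one_ne_zero h0
        simp at this
        linarith
      · rw [ENNReal.ofReal_lt_one]
        exact Real.exp_lt_one_iff.mpr (by linarith [hpos z hz])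
    simpa using this
  set p := (∫⁻ z, ENNReal.ofReal (Real.exp (-h z)) ∂stdGaussian).toReal with hp
  have hpe : ∫⁻ z, ENNReal.ofReal (Real.exp (-h z)) ∂stdGaussian = ENNReal.ofReal p :=
    (ENNReal.ofReal_toReal hlt.ne_top).symm
  have hp1 : p < 1 := by
    rw [hpe, ENNReal.ofReal_lt_one] at hlt; exact hlt
  have hp0 : 0 ≤ p := ENNReal.toReal_nonneg
  refine ⟨(1 - p) / 2, by linarith, ?_⟩
  rw [hpe]
  refine ENNReal.ofReal_le_ofReal ?_
  have := Real.add_one_le_exp (-(2 * ((1 - p) / 2)))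
  linarith

/-- Chernoff's lower tail bound for sums of i.i.d. nonnegative functions of Gaussians. -/
lemma measure_sum_lt_le {h : ℝ → ℝ} (hm : Measurable h) {c : ℝ}
    (hc : ∫⁻ z, ENNReal.ofReal (Real.exp (-h z)) ∂stdGaussian ≤
      ENNReal.ofReal (Real.exp (-(2 * c)))) (m : ℕ) :
    (Measure.pi fun _ : Fin m => stdGaussian) {ζ | ∑ i, h (ζ i) < c * m} ≤
      ENNReal.ofReal (Real.exp (-(c * m))) := by
  have h1 : ∫⁻ ζ, ∏ i, ENNReal.ofReal (Real.exp (-h (ζ i)))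
      ∂(Measure.pi fun _ : Fin m => stdGaussian) ≤ ENNReal.ofReal (Real.exp (-(2 * c) * m)) := by
    rw [lintegral_pi_prod (f := fun _ z => ENNReal.ofReal (Real.exp (-h z))) _
      fun _ => by fun_prop]
    refine (Finset.prod_le_prod' fun _ _ => hc).trans ?_
    rw [Finset.prod_const, ← ENNReal.ofReal_pow (Real.exp_pos _).le, ← Real.exp_nat_mul]
    simp [mul_comm]
  have hsub : {ζ : Fin m → ℝ | ∑ i, h (ζ i) < c * m} ⊆
      {ζ | ENNReal.ofReal (Real.exp (-(c * m))) ≤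
        ∏ i, ENNReal.ofReal (Real.exp (-h (ζ i)))} := by
    intro ζ hζ
    simp only [Set.mem_ofPred_eq] at hζ ⊢
    rw [← ENNReal.ofReal_prod_of_nonneg fun _ _ => (Real.exp_pos _).le, ← Real.exp_sum]
    refine ENNReal.ofReal_le_ofReal (Real.exp_le_exp.mpr ?_)
    rw [Finset.sum_neg_distrib]
    linarith
  refine (measure_mono hsub).trans ?_
  have hpos : ENNReal.ofReal (Real.exp (-(c * m))) ≠ 0 := by simp [Real.exp_pos]
  refine (meas_ge_le_lintegral_div (Measurable.aemeasurable (by fun_prop)) hpos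
    ENNReal.ofReal_ne_top).trans ?_
  refine (ENNReal.div_le_div_right h1 _).trans ?_
  rw [← ENNReal.ofReal_div_of_pos (Real.exp_pos _), ← Real.exp_sub]
  refine ENNReal.ofReal_le_ofReal (Real.exp_le_exp.mpr ?_)
  linarith

/-- If an event has probability at most `exp (-a)`, then among `q` independent copies at least `b`
occur with probability at most `2 ^ q * exp (-a * b)`. -/
lemma measure_count_ge_le {α : Type*} [MeasurableSpace α] (P : Measure α) [IsProbabilityMeasure P]
    {S : Set α} (hS : MeasurableSet S) {a : ℝ} (h : P S ≤ ENNReal.ofReal (Real.exp (-a)))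
    (q : ℕ) (b : ℝ) (ha : 0 ≤ a) [DecidablePred (· ∈ S)] :
    (Measure.pi fun _ : Fin q => P)
      {x | b ≤ ((Finset.univ.filter fun k => x k ∈ S).card : ℝ)} ≤
      ENNReal.ofReal (2 ^ q * Real.exp (-(a * b))) := by
  set f : α → ℝ≥0∞ := fun x => 1 + S.indicator (fun _ => ENNReal.ofReal (Real.exp a)) x with hf
  have hfm : Measurable f := (measurable_const.indicator hS).const_add 1
  have hfi : ∫⁻ x, f x ∂P ≤ 2 := by
    rw [hf, lintegral_add_left measurable_const, lintegral_indicator_const hS]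
    have : ENNReal.ofReal (Real.exp a) * P S ≤ 1 := by
      refine (mul_le_mul_right h _).trans ?_
      rw [← ENNReal.ofReal_mul (Real.exp_pos _).le, ← Real.exp_add]
      simp
    simpa [← one_add_one_eq_two] using this
  have h1 : ∫⁻ x, ∏ k, f (x k) ∂(Measure.pi fun _ : Fin q => P) ≤ 2 ^ q := by
    rw [lintegral_pi_prod (f := fun _ => f) _ fun _ => hfm]
    refine (Finset.prod_le_prod' fun _ _ => hfi).trans ?_
    simp
  have hsub : {x : Fin q → α | b ≤ ((Finset.univ.filter fun k => x k ∈ S).card : ℝ)} ⊆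
      {x | ENNReal.ofReal (Real.exp (a * b)) ≤ ∏ k, f (x k)} := by
    intro x hx
    simp only [Set.mem_ofPred_eq] at hx ⊢
    have : ENNReal.ofReal (Real.exp (a * b)) ≤
        ENNReal.ofReal (Real.exp a) ^ (Finset.univ.filter fun k => x k ∈ S).card := by
      rw [← ENNReal.ofReal_pow (Real.exp_pos _).le, ← Real.exp_nat_mul]
      refine ENNReal.ofReal_le_ofReal (Real.exp_le_exp.mpr ?_)
      nlinarith
    refine this.trans ?_
    rw [← Finset.prod_const, Finset.prod_filter]
    refine Finset.prod_le_prod' fun k _ => ?_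
    by_cases hk : x k ∈ S
    · simp [hf, hk]
    · simp [hf, hk]
  refine (measure_mono hsub).trans ?_
  have hpos : ENNReal.ofReal (Real.exp (a * b)) ≠ 0 := by simp [Real.exp_pos]
  refine (meas_ge_le_lintegral_div (Measurable.aemeasurable
    (Finset.measurable_fun_prod _ fun k _ => hfm.comp (measurable_pi_apply k))) hpos
    ENNReal.ofReal_ne_top).trans ?_
  refine (ENNReal.div_le_div_right h1 _).trans ?_
  have : (2 : ℝ≥0∞) ^ q = ENNReal.ofReal (2 ^ q) := by
    rw [ENNReal.ofReal_pow (by norm_num)]; simp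
  rw [this, ← ENNReal.ofReal_div_of_pos (Real.exp_pos _), div_eq_mul_inv, ← Real.exp_neg]

/-- Upper tail of a weighted sum of squares of independent standard Gaussians. -/
lemma measure_sum_sq_ge_le {q m : ℕ} {ρ : Fin q → ℝ} {l : ℝ} (hl : 0 ≤ l)
    (hρ : ∀ k, l * ρ k ^ 2 ≤ 1 / 4) :
    (Measure.pi fun _ : Fin q => Measure.pi fun _ : Fin m => stdGaussian)
      {ζ | 4 * m * ∑ k, ρ k ^ 2 ≤ ∑ k, ∑ i, (ρ k * ζ k i) ^ 2} ≤
      ENNReal.ofReal (Real.exp (-(2 * l * m * ∑ k, ρ k ^ 2))) := by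
  have h1 : ∫⁻ ζ, ∏ k, ∏ i, ENNReal.ofReal (Real.exp (l * ρ k ^ 2 * ζ k i ^ 2))
      ∂(Measure.pi fun _ : Fin q => Measure.pi fun _ : Fin m => stdGaussian) ≤
      ENNReal.ofReal (Real.exp (2 * l * m * ∑ k, ρ k ^ 2)) := by
    rw [lintegral_pi_prod (f := fun k (z : Fin m → ℝ) =>
      ∏ i, ENNReal.ofReal (Real.exp (l * ρ k ^ 2 * z i ^ 2))) _ fun _ => by fun_prop]
    rw [Finset.mul_sum, Real.exp_sum, ENNReal.ofReal_prod_of_nonneg fun _ _ => (Real.exp_pos _).le]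
    refine Finset.prod_le_prod' fun k _ => ?_
    rw [lintegral_pi_prod (f := fun _ z => ENNReal.ofReal (Real.exp (l * ρ k ^ 2 * z ^ 2))) _
      fun _ => by fun_prop]
    refine (Finset.prod_le_prod' fun _ _ =>
      lintegral_exp_mul_sq_stdGaussian_le (by positivity) (hρ k)).trans ?_
    rw [Finset.prod_const, ← ENNReal.ofReal_pow (Real.exp_pos _).le, ← Real.exp_nat_mul]
    refine ENNReal.ofReal_le_ofReal (Real.exp_le_exp.mpr ?_)
    simp only [Finset.card_univ, Fintype.card_fin]
    exact le_of_eq (by ring)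
  have hsub : {ζ : Fin q → Fin m → ℝ |
        4 * m * ∑ k, ρ k ^ 2 ≤ ∑ k, ∑ i, (ρ k * ζ k i) ^ 2} ⊆
      {ζ | ENNReal.ofReal (Real.exp (4 * l * m * ∑ k, ρ k ^ 2)) ≤
        ∏ k, ∏ i, ENNReal.ofReal (Real.exp (l * ρ k ^ 2 * ζ k i ^ 2))} := by
    intro ζ hζ
    simp only [Set.mem_ofPred_eq] at hζ ⊢
    simp_rw [← ENNReal.ofReal_prod_of_nonneg fun _ _ => (Real.exp_pos _).le, ← Real.exp_sum]
    rw [← ENNReal.ofReal_prod_of_nonneg fun _ _ => (Real.exp_pos _).le, ← Real.exp_sum]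
    refine ENNReal.ofReal_le_ofReal (Real.exp_le_exp.mpr ?_)
    have : ∑ k, ∑ i, l * ρ k ^ 2 * ζ k i ^ 2 = l * ∑ k, ∑ i, (ρ k * ζ k i) ^ 2 := by
      simp_rw [Finset.mul_sum]
      exact Finset.sum_congr rfl fun k _ => Finset.sum_congr rfl fun i _ => by ring
    rw [this]
    nlinarith
  refine (measure_mono hsub).trans ?_
  have hpos : ENNReal.ofReal (Real.exp (4 * l * m * ∑ k, ρ k ^ 2)) ≠ 0 := by simp [Real.exp_pos]
  refine (meas_ge_le_lintegral_div (Measurable.aemeasurable (by fun_prop)) hpos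
    ENNReal.ofReal_ne_top).trans ?_
  refine (ENNReal.div_le_div_right h1 _).trans ?_
  rw [← ENNReal.ofReal_div_of_pos (Real.exp_pos _), ← Real.exp_sub]
  refine ENNReal.ofReal_le_ofReal (Real.exp_le_exp.mpr ?_)
  linarith

lemma lintegral_exp_dotProduct_gaussianVec {n : ℕ} (v : Fin n → ℝ) :
    ∫⁻ x, ENNReal.ofReal (Real.exp (v ⬝ᵥ x)) ∂(gaussianVec n) =
      ENNReal.ofReal (Real.exp ((v ⬝ᵥ v) / 2)) := by
  have h : ∀ x : Fin n → ℝ, ENNReal.ofReal (Real.exp (v ⬝ᵥ x)) =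
      ∏ j, ENNReal.ofReal (Real.exp (v j * x j)) := by
    intro x
    rw [dotProduct, Real.exp_sum, ENNReal.ofReal_prod_of_nonneg fun _ _ => (Real.exp_pos _).le]
  simp_rw [h]
  rw [gaussianVec, lintegral_pi_prod (f := fun j z => ENNReal.ofReal (Real.exp (v j * z))) _
    fun _ => by fun_prop]
  simp_rw [lintegral_exp_mul_stdGaussian]
  rw [← ENNReal.ofReal_prod_of_nonneg fun _ _ => (Real.exp_pos _).le, ← Real.exp_sum, dotProduct,
    Finset.sum_div]
  simp_rw [pow_two]

lemma lintegral_exp_sum_gaussianMatrices {q m n : ℕ} (v : Fin q → Fin m → Fin n → ℝ) :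
    ∫⁻ ω, ENNReal.ofReal (Real.exp (∑ k, ∑ i, v k i ⬝ᵥ ω k i)) ∂(gaussianMatrices q m n) =
      ENNReal.ofReal (Real.exp ((∑ k, ∑ i, v k i ⬝ᵥ v k i) / 2)) := by
  have h : ∀ ω : Fin q → Fin m → Fin n → ℝ,
      ENNReal.ofReal (Real.exp (∑ k, ∑ i, v k i ⬝ᵥ ω k i)) =
      ∏ k, ∏ i, ENNReal.ofReal (Real.exp (v k i ⬝ᵥ ω k i)) := by
    intro ω
    simp_rw [Real.exp_sum]
    rw [ENNReal.ofReal_prod_of_nonneg fun _ _ => Finset.prod_nonneg fun _ _ => (Real.exp_pos _).le]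
    simp_rw [ENNReal.ofReal_prod_of_nonneg fun _ _ => (Real.exp_pos _).le]
  simp_rw [h]
  have hmeas : ∀ w : Fin n → ℝ, Measurable fun x => ENNReal.ofReal (Real.exp (w ⬝ᵥ x)) := by
    intro w
    unfold dotProduct
    fun_prop
  rw [gaussianMatrices, lintegral_pi_prod (f := fun k (x : Fin m → Fin n → ℝ) =>
    ∏ i, ENNReal.ofReal (Real.exp (v k i ⬝ᵥ x i))) _ fun k => Finset.measurable_fun_prod _
      fun i _ => (hmeas _).comp (measurable_pi_apply i)]
  have : ∀ k, ∫⁻ x : Fin m → Fin n → ℝ, ∏ i, ENNReal.ofReal (Real.exp (v k i ⬝ᵥ x i))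
      ∂(Measure.pi fun _ => gaussianVec n) =
      ENNReal.ofReal (Real.exp ((∑ i, v k i ⬝ᵥ v k i) / 2)) := by
    intro k
    rw [lintegral_pi_prod (f := fun i x => ENNReal.ofReal (Real.exp (v k i ⬝ᵥ x))) _
      fun i => hmeas _]
    simp_rw [lintegral_exp_dotProduct_gaussianVec]
    rw [← ENNReal.ofReal_prod_of_nonneg fun _ _ => (Real.exp_pos _).le, ← Real.exp_sum,
      Finset.sum_div]
  simp_rw [this]
  rw [← ENNReal.ofReal_prod_of_nonneg fun _ _ => (Real.exp_pos _).le, ← Real.exp_sum,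
      Finset.sum_div]

lemma vnorm_ofLp {n : ℕ} (w : EuclideanSpace ℝ (Fin n)) : vnorm w.ofLp = ‖w‖ := by
  rw [EuclideanSpace.norm_eq, vnorm]
  simp

/-- If a matrix is not bounded by `t`, then its bilinear form exceeds `t / 8` on a product of two
balls of radius `1 / 4` contained in the unit balls. -/
lemma exists_balls_bilin_ge {n q : ℕ} {N : Matrix (Fin n) (Fin q) ℝ} {t : ℝ} (ht : 0 ≤ t)
    (hN : ¬ ∀ z, vnorm (N *ᵥ z) ≤ t * vnorm z) :
    ∃ (w₀ : EuclideanSpace ℝ (Fin n)) (z₀ : EuclideanSpace ℝ (Fin q)),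
      Metric.ball w₀ (1 / 4) ⊆ Metric.ball 0 1 ∧ Metric.ball z₀ (1 / 4) ⊆ Metric.ball 0 1 ∧
      ∀ w ∈ Metric.ball w₀ (1 / 4), ∀ z ∈ Metric.ball z₀ (1 / 4),
        t / 8 ≤ w.ofLp ⬝ᵥ (N *ᵥ z.ofLp) := by
  push Not at hN
  obtain ⟨x, hx⟩ := hN
  have hx0 : x ≠ 0 := by
    rintro rfl
    simp [vnorm] at hx
  obtain ⟨y, hy1, hy⟩ := isCompact_vnorm_sphere.exists_isMaxOn ⟨_, vnorm_normalize hx0⟩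
    (f := fun z => vnorm (N *ᵥ z))
    (continuous_vnorm.comp (by fun_prop)).continuousOn
  set s := vnorm (N *ᵥ y) with hs
  have hmax : ∀ z, vnorm (N *ᵥ z) ≤ s * vnorm z := by
    intro z
    by_cases hz : z = 0
    · simp [hz, vnorm]
    have h : vnorm (N *ᵥ ((vnorm z)⁻¹ • z)) ≤ s := hy (vnorm_normalize hz)
    rw [mulVec_smul, vnorm_smul, abs_of_nonneg (inv_nonneg.mpr (vnorm_nonneg z)),
      inv_mul_le_iff₀ (vnorm_pos hz)] at h
    linarith
  have hst : t < s := by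
    have := hx.trans_le (hmax x)
    exact lt_of_mul_lt_mul_right this (vnorm_nonneg x)
  have hs0 : 0 < s := ht.trans_lt hst
  have hNy0 : N *ᵥ y ≠ 0 := by
    intro h
    rw [hs, h] at hs0
    simp [vnorm] at hs0
  set v := (vnorm (N *ᵥ y))⁻¹ • (N *ᵥ y) with hv
  have hv1 : vnorm v = 1 := vnorm_normalize hNy0
  have hvy : v ⬝ᵥ (N *ᵥ y) = s := by
    rw [hv, smul_dotProduct, ← vnorm_sq, smul_eq_mul, ← hs]
    field_simp
  have hball : ∀ {d : ℕ} (a : Fin d → ℝ), vnorm a = 1 →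
      Metric.ball (WithLp.toLp 2 ((3 / 4 : ℝ) • a) : EuclideanSpace ℝ (Fin d)) (1 / 4) ⊆
        Metric.ball 0 1 := by
    intro d a ha
    refine Metric.ball_subset_ball' ?_
    rw [dist_zero_right, ← vnorm_ofLp, vnorm_smul, ha]
    norm_num
  refine ⟨WithLp.toLp 2 ((3 / 4 : ℝ) • v), WithLp.toLp 2 ((3 / 4 : ℝ) • y), hball v hv1,
    hball y hy1, fun w hw z hz => ?_⟩
  rw [mem_ball_iff_norm, ← vnorm_ofLp] at hw hz
  obtain ⟨e, he⟩ : ∃ e : Fin n → ℝ, e = w.ofLp - (3 / 4 : ℝ) • v := ⟨_, rfl⟩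
  obtain ⟨f, hf⟩ : ∃ f : Fin q → ℝ, f = z.ofLp - (3 / 4 : ℝ) • y := ⟨_, rfl⟩
  have he' : vnorm e < 1 / 4 := by rw [he]; exact hw
  have hf' : vnorm f < 1 / 4 := by rw [hf]; exact hz
  have hwe : w.ofLp = (3 / 4 : ℝ) • v + e := by rw [he]; abel
  have hze : z.ofLp = (3 / 4 : ℝ) • y + f := by rw [hf]; abel
  have key : ∀ (a : Fin n → ℝ) (b : Fin q → ℝ), -(vnorm a * (s * vnorm b)) ≤ a ⬝ᵥ (N *ᵥ b) := by
    intro a b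
    have h1 := dotProduct_le_vnorm_mul_vnorm (-a) (N *ᵥ b)
    have h2 : vnorm (-a) = vnorm a := by simp [vnorm]
    rw [neg_dotProduct, h2] at h1
    have := mul_le_mul_of_nonneg_left (hmax b) (vnorm_nonneg a)
    linarith
  rw [hwe, hze]
  simp only [mulVec_add, mulVec_smul, add_dotProduct, dotProduct_add, smul_dotProduct,
    dotProduct_smul, smul_eq_mul, hvy]
  have k1 := key v f
  have k2 := key e y
  have k3 := key e f
  rw [hv1] at k1
  rw [hy1] at k2
  have e0 := vnorm_nonneg e
  have f0 := vnorm_nonneg f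
  have b1 : s * vnorm f ≤ s * (1 / 4) := by gcongr
  have b2 : vnorm e * s ≤ 1 / 4 * s := by gcongr
  have b3 : vnorm e * (s * vnorm f) ≤ 1 / 4 * (s * (1 / 4)) := by gcongr
  linarith

/-- A volumetric bound for the operator norm of a random matrix whose bilinear form has bounded
exponential moments. -/
lemma measure_not_bounded_le {Ω : Type*} [MeasurableSpace Ω] (P : Measure Ω)
    [IsProbabilityMeasure P] {n q : ℕ} {N : Ω → Matrix (Fin n) (Fin q) ℝ}
    (hm : ∀ i j, Measurable fun ω => N ω i j) {l K t : ℝ} (hl : 0 ≤ l) (ht : 0 ≤ t)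
    (h : ∀ w z, vnorm w ≤ 1 → vnorm z ≤ 1 →
      ∫⁻ ω, ENNReal.ofReal (Real.exp (l * (w ⬝ᵥ (N ω *ᵥ z)))) ∂P ≤ ENNReal.ofReal (Real.exp K)) :
    P {ω | ¬ ∀ z, vnorm (N ω *ᵥ z) ≤ t * vnorm z} ≤
      ENNReal.ofReal (4 ^ (n + q) * Real.exp (K - l * t / 8)) := by
  set Bw : Set (EuclideanSpace ℝ (Fin n)) := Metric.ball 0 1
  set Bz : Set (EuclideanSpace ℝ (Fin q)) := Metric.ball 0 1
  set g : Ω → EuclideanSpace ℝ (Fin n) → EuclideanSpace ℝ (Fin q) → ℝ≥0∞ := fun ω w z =>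
    ENNReal.ofReal (Real.exp (l * (w.ofLp ⬝ᵥ (N ω *ᵥ z.ofLp)))) with hg
  have hgm : Measurable fun p : Ω × EuclideanSpace ℝ (Fin n) × EuclideanSpace ℝ (Fin q) =>
      g p.1 p.2.1 p.2.2 := by
    simp only [hg, dotProduct, mulVec]
    refine ENNReal.measurable_ofReal.comp (Real.measurable_exp.comp (Measurable.const_mul ?_ _))
    refine Finset.measurable_fun_sum _ fun i _ => Measurable.mul (by fun_prop) ?_
    refine Finset.measurable_fun_sum _ fun j _ => Measurable.mul ?_ (by fun_prop)
    exact (hm i j).comp measurable_fst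
  set G : Ω → ℝ≥0∞ := fun ω => ∫⁻ p in Bw ×ˢ Bz, g ω p.1 p.2 with hG
  have hGm : Measurable G := Measurable.lintegral_prod_right hgm
  have hV : volume (Bw ×ˢ Bz) = volume Bw * volume Bz := by
    rw [Measure.volume_eq_prod, Measure.prod_prod]
  have hV0 : volume (Bw ×ˢ Bz) ≠ 0 := by
    rw [hV]
    exact mul_ne_zero (Metric.measure_ball_pos _ _ one_pos).ne'
      (Metric.measure_ball_pos _ _ one_pos).ne'
  have hVt : volume (Bw ×ˢ Bz) ≠ ∞ := by
    rw [hV]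
    exact ENNReal.mul_ne_top measure_ball_lt_top.ne measure_ball_lt_top.ne
  have hGi : ∫⁻ ω, G ω ∂P ≤ ENNReal.ofReal (Real.exp K) * volume (Bw ×ˢ Bz) := by
    rw [hG, lintegral_lintegral_swap hgm.aemeasurable, ← setLIntegral_const]
    refine setLIntegral_mono' (measurableSet_ball.prod measurableSet_ball) fun p hp => ?_
    refine h _ _ ?_ ?_
    · rw [vnorm_ofLp]; exact (mem_ball_zero_iff.mp hp.1).le
    · rw [vnorm_ofLp]; exact (mem_ball_zero_iff.mp hp.2).le
  set ε : ℝ≥0∞ := ENNReal.ofReal (Real.exp (l * t / 8)) *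
    (ENNReal.ofReal ((1 / 4) ^ (n + q)) * volume (Bw ×ˢ Bz)) with hε
  have hε0 : ε ≠ 0 := by
    refine mul_ne_zero (by simp [Real.exp_pos]) (mul_ne_zero ?_ hV0)
    simp
  have hεt : ε ≠ ∞ :=
    ENNReal.mul_ne_top ENNReal.ofReal_ne_top (ENNReal.mul_ne_top ENNReal.ofReal_ne_top hVt)
  have hsub : {ω | ¬ ∀ z, vnorm (N ω *ᵥ z) ≤ t * vnorm z} ⊆ {ω | ε ≤ G ω} := by
    intro ω hω
    obtain ⟨w₀, z₀, hw, hz, hwz⟩ := exists_balls_bilin_ge ht hω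
    have hvol : volume (Metric.ball w₀ (1 / 4) ×ˢ Metric.ball z₀ (1 / 4)) =
        ENNReal.ofReal ((1 / 4) ^ (n + q)) * volume (Bw ×ˢ Bz) := by
      rw [hV, Measure.volume_eq_prod, Measure.prod_prod,
        Measure.addHaar_ball_of_pos _ w₀ (by norm_num : (0 : ℝ) < 1 / 4),
        Measure.addHaar_ball_of_pos _ z₀ (by norm_num : (0 : ℝ) < 1 / 4), pow_add, ENNReal.ofReal_mul (by positivity)]
      simp only [finrank_euclideanSpace, Fintype.card_fin]
      ring
    change ε ≤ G ω
    rw [hε, ← hvol, ← setLIntegral_const]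
    calc _ ≤ ∫⁻ p in Metric.ball w₀ (1 / 4) ×ˢ Metric.ball z₀ (1 / 4), g ω p.1 p.2 := by
          refine setLIntegral_mono' (measurableSet_ball.prod measurableSet_ball) fun p hp => ?_
          refine ENNReal.ofReal_le_ofReal (Real.exp_le_exp.mpr ?_)
          have := mul_le_mul_of_nonneg_left (hwz _ hp.1 _ hp.2) hl
          linarith
      _ ≤ _ := lintegral_mono_set (Set.prod_mono hw hz)
  refine (measure_mono hsub).trans ?_
  refine (meas_ge_le_lintegral_div hGm.aemeasurable hε0 hεt).trans ?_
  refine ENNReal.div_le_of_le_mul (hGi.trans (le_of_eq ?_))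
  rw [hε, ← mul_assoc, ← mul_assoc, ← ENNReal.ofReal_mul (by positivity),
    ← ENNReal.ofReal_mul (by positivity)]
  congr 2
  have h4 : (4 : ℝ) ^ (n + q) * (1 / 4) ^ (n + q) = 1 := by rw [← mul_pow]; norm_num
  have hexp : Real.exp K = Real.exp (K - l * t / 8) * Real.exp (l * t / 8) := by
    rw [← Real.exp_add]; ring_nf
  linear_combination hexp - Real.exp (K - l * t / 8) * Real.exp (l * t / 8) * h4

/-- The part of the truncated initialization matrix coming from the measurement components
orthogonal to the unknown columns `ρ k • u k`. -/
noncomputable def noiseMat {n q m : ℕ} (ρ : Fin q → ℝ) (u : Fin q → Fin n → ℝ) (β : ℝ)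
    (ζ : Fin q → Fin m → ℝ) (ω : Fin q → Fin m → Fin n → ℝ) : Matrix (Fin n) (Fin q) ℝ :=
  Matrix.of fun j k => (1 / (m : ℝ)) * ∑ i, (ω k i - (u k ⬝ᵥ ω k i) • u k) j *
    (ρ k * ζ k i * (if (ρ k * ζ k i) ^ 2 ≤ β then 1 else 0))

/-- The measurement vectors with prescribed components `ζ` along the unit vectors `u` and
components orthogonal to `u` taken from `ω`. -/
def gaussSplit {n q m : ℕ} (u : Fin q → Fin n → ℝ)
    (p : (Fin q → Fin m → ℝ) × (Fin q → Fin m → Fin n → ℝ)) : Fin q → Fin m → Fin n → ℝ :=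
  fun k i => p.1 k i • u k + (p.2 k i - (u k ⬝ᵥ p.2 k i) • u k)

lemma measurePreserving_gaussSplit {n q m : ℕ} {u : Fin q → Fin n → ℝ}
    (hu : ∀ k, u k ⬝ᵥ u k = 1) :
    MeasurePreserving (gaussSplit (m := m) u)
      ((Measure.pi fun _ : Fin q => Measure.pi fun _ : Fin m => stdGaussian).prod
        (gaussianMatrices q m n)) (gaussianMatrices q m n) := by
  have h1 : ∀ k, MeasurePreserving
      (fun (p : (Fin m → ℝ) × (Fin m → Fin n → ℝ)) i =>
        p.1 i • u k + (p.2 i - (u k ⬝ᵥ p.2 i) • u k))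
      ((Measure.pi fun _ : Fin m => stdGaussian).prod (Measure.pi fun _ => gaussianVec n))
      (Measure.pi fun _ => gaussianVec n) := fun k =>
    measurePreserving_pi_prod (T := fun _ p => p.1 • u k + (p.2 - (u k ⬝ᵥ p.2) • u k)) _ _ _
      fun _ => measurePreserving_gaussian_split (hu k)
  exact measurePreserving_pi_prod
    (T := fun k (p : (Fin m → ℝ) × (Fin m → Fin n → ℝ)) i =>
        p.1 i • u k + (p.2 i - (u k ⬝ᵥ p.2 i) • u k)) _ _ _ h1

lemma gaussSplit_dotProduct {n q m : ℕ} {u : Fin q → Fin n → ℝ} (hu : ∀ k, u k ⬝ᵥ u k = 1)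
    (ρ : Fin q → ℝ) (p : (Fin q → Fin m → ℝ) × (Fin q → Fin m → Fin n → ℝ)) (k : Fin q)
    (i : Fin m) : gaussSplit u p k i ⬝ᵥ (ρ k • u k) = ρ k * p.1 k i := by
  simp only [gaussSplit, dotProduct_smul, add_dotProduct, sub_dotProduct, smul_dotProduct, hu,
    smul_eq_mul, dotProduct_comm (p.2 k i)]
  ring

lemma initMat_gaussSplit {n q m : ℕ} {u : Fin q → Fin n → ℝ} (hu : ∀ k, u k ⬝ᵥ u k = 1)
    {X : Matrix (Fin n) (Fin q) ℝ} {ρ : Fin q → ℝ} (hX : ∀ k, matCol X k = ρ k • u k) (β : ℝ)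
    (p : (Fin q → Fin m → ℝ) × (Fin q → Fin m → Fin n → ℝ)) :
    initMat (fun k => matCol X k) β (gaussSplit u p) =
      X * diagonal (fun k => (1 / (m : ℝ)) *
        ∑ i, p.1 k i ^ 2 * (if (ρ k * p.1 k i) ^ 2 ≤ β then 1 else 0)) +
      noiseMat ρ u β p.1 p.2 := by
  ext j k
  have hXjk : X j k = ρ k * u k j := congrFun (hX k) j
  rw [Matrix.add_apply, mul_diagonal, hXjk]
  simp only [initMat, noiseMat, Matrix.of_apply, hX, gaussSplit_dotProduct hu]
  rw [mul_left_comm, ← mul_add]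
  congr 1
  rw [Finset.mul_sum, ← Finset.sum_add_distrib]
  refine Finset.sum_congr rfl fun i _ => ?_
  simp only [gaussSplit, Pi.add_apply, Pi.smul_apply, smul_eq_mul]
  ring

lemma initAlpha_gaussSplit {n q m : ℕ} {u : Fin q → Fin n → ℝ} (hu : ∀ k, u k ⬝ᵥ u k = 1)
    {X : Matrix (Fin n) (Fin q) ℝ} {ρ : Fin q → ℝ} (hX : ∀ k, matCol X k = ρ k • u k) (C : ℝ)
    (p : (Fin q → Fin m → ℝ) × (Fin q → Fin m → Fin n → ℝ)) :
    initAlpha (fun k => matCol X k) C (gaussSplit u p) =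
      C * ((∑ k, ∑ i, (ρ k * p.1 k i) ^ 2) / ((m : ℝ) * q)) := by
  simp only [initAlpha, hX, gaussSplit_dotProduct hu]

lemma dotProduct_noiseMat_mulVec {n q m : ℕ} (ρ : Fin q → ℝ) (u : Fin q → Fin n → ℝ) (β : ℝ)
    (ζ : Fin q → Fin m → ℝ) (ω : Fin q → Fin m → Fin n → ℝ) (w : Fin n → ℝ) (z : Fin q → ℝ) :
    w ⬝ᵥ (noiseMat ρ u β ζ ω *ᵥ z) =
      ∑ k, ∑ i, ((z k / m * (ρ k * ζ k i * (if (ρ k * ζ k i) ^ 2 ≤ β then 1 else 0))) •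
        (w - (u k ⬝ᵥ w) • u k)) ⬝ᵥ ω k i := by
  have h1 : w ⬝ᵥ (noiseMat ρ u β ζ ω *ᵥ z) = ∑ k, ∑ j, w j * (noiseMat ρ u β ζ ω j k * z k) := by
    simp only [dotProduct, mulVec, Finset.mul_sum]
    exact Finset.sum_comm
  rw [h1]
  refine Finset.sum_congr rfl fun k _ => ?_
  simp only [noiseMat, Matrix.of_apply, Finset.mul_sum, Finset.sum_mul]
  rw [Finset.sum_comm]
  refine Finset.sum_congr rfl fun i _ => ?_
  have h2 : (w - (u k ⬝ᵥ w) • u k) ⬝ᵥ ω k i = w ⬝ᵥ (ω k i - (u k ⬝ᵥ ω k i) • u k) := by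
    simp only [sub_dotProduct, dotProduct_sub, smul_dotProduct, dotProduct_smul, smul_eq_mul,
      dotProduct_comm w (u k)]
    ring
  rw [smul_dotProduct, h2, smul_eq_mul]
  simp only [dotProduct, Finset.mul_sum]
  refine Finset.sum_congr rfl fun j _ => ?_
  ring

lemma lintegral_exp_noiseMat_le {n q m : ℕ} (hm : 0 < m) {ρ : Fin q → ℝ} {u : Fin q → Fin n → ℝ}
    (hu : ∀ k, u k ⬝ᵥ u k = 1) {β a : ℝ} (ha : 0 ≤ a) (hβ : β ≤ a) (ζ : Fin q → Fin m → ℝ) (l : ℝ)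
    {w : Fin n → ℝ} {z : Fin q → ℝ} (hw : vnorm w ≤ 1) (hz : vnorm z ≤ 1) :
    ∫⁻ ω, ENNReal.ofReal (Real.exp (l * (w ⬝ᵥ (noiseMat ρ u β ζ ω *ᵥ z))))
      ∂(gaussianMatrices q m n) ≤ ENNReal.ofReal (Real.exp (l ^ 2 * a / (2 * m))) := by
  have hm' : (0 : ℝ) < m := by exact_mod_cast hm
  simp_rw [dotProduct_noiseMat_mulVec, Finset.mul_sum, ← smul_eq_mul l, ← smul_dotProduct l]
  rw [lintegral_exp_sum_gaussianMatrices]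
  refine ENNReal.ofReal_le_ofReal (Real.exp_le_exp.mpr ?_)
  have hw1 : w ⬝ᵥ w ≤ 1 := by
    rw [← vnorm_sq]; exact pow_le_one₀ (vnorm_nonneg w) hw
  have hz1 : ∑ k, z k ^ 2 ≤ 1 := by
    have : vnorm z ^ 2 ≤ 1 := pow_le_one₀ (vnorm_nonneg z) hz
    rwa [vnorm_sq, dotProduct, ← Finset.sum_congr rfl fun k _ => pow_two (z k)] at this
  have hterm : ∀ k i, (l • ((z k / m * (ρ k * ζ k i *
        (if (ρ k * ζ k i) ^ 2 ≤ β then 1 else 0))) • (w - (u k ⬝ᵥ w) • u k))) ⬝ᵥ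
      (l • ((z k / m * (ρ k * ζ k i *
        (if (ρ k * ζ k i) ^ 2 ≤ β then 1 else 0))) • (w - (u k ⬝ᵥ w) • u k))) ≤
      l ^ 2 * a / m ^ 2 * z k ^ 2 := by
    intro k i
    set g : ℝ := ρ k * ζ k i * (if (ρ k * ζ k i) ^ 2 ≤ β then 1 else 0) with hg
    have hg2 : g ^ 2 ≤ a := by
      rw [hg]
      split_ifs with h
      · rw [mul_one]; exact h.trans hβ
      · simpa using ha
    have hp : (w - (u k ⬝ᵥ w) • u k) ⬝ᵥ (w - (u k ⬝ᵥ w) • u k) ≤ 1 := by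
      simp only [sub_dotProduct, dotProduct_sub, smul_dotProduct, dotProduct_smul, smul_eq_mul,
        dotProduct_comm w (u k), hu]
      nlinarith [sq_nonneg (u k ⬝ᵥ w)]
    have hp0 := dotProduct_self_nonneg_real (w - (u k ⬝ᵥ w) • u k)
    simp only [smul_dotProduct, dotProduct_smul, smul_eq_mul]
    calc _ = l ^ 2 * (z k) ^ 2 / m ^ 2 * (g ^ 2 *
          ((w - (u k ⬝ᵥ w) • u k) ⬝ᵥ (w - (u k ⬝ᵥ w) • u k))) := by ring
      _ ≤ l ^ 2 * (z k) ^ 2 / m ^ 2 * (a * 1) := by gcongr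
      _ = _ := by ring
  calc _ ≤ (∑ k, ∑ _i : Fin m, l ^ 2 * a / m ^ 2 * z k ^ 2) / 2 := by
        gcongr with k _ i _
        exact hterm k i
    _ = l ^ 2 * a / (2 * m) * ∑ k, z k ^ 2 := by
        simp only [Finset.sum_const, Finset.card_univ, Fintype.card_fin, nsmul_eq_mul]
        simp_rw [← mul_assoc]
        rw [← Finset.mul_sum]
        field_simp
    _ ≤ l ^ 2 * a / (2 * m) * 1 := by gcongr
    _ = _ := mul_one _

/-- Deterministic perturbation bound: if the signal part `Us * B * diagonal D` keeps most columns
and the remaining part `N` is small in operator norm, the leading left singular space of the sum is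
close to the span of `Us`. -/
lemma SD_sq_le_of_signal_add_noise {n q r : ℕ} {Us U : Matrix (Fin n) (Fin r) ℝ}
    {B : Matrix (Fin r) (Fin q) ℝ} {N : Matrix (Fin n) (Fin q) ℝ} {D : Fin q → ℝ}
    (hUs : Usᵀ * Us = 1) {σ c t M : ℝ} (hσ : 0 < σ) (hc : 0 < c) (ht : 0 ≤ t)
    (htc : t ≤ c * σ / 4) (hB : ∀ w, σ * vnorm w ≤ vnorm (Bᵀ *ᵥ w))
    (hM : ∀ k, vnorm (matCol B k) ^ 2 ≤ M) (bad : Finset (Fin q))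
    (hbad : M * bad.card ≤ σ ^ 2 / 2) (hD : ∀ k, k ∉ bad → c ≤ D k)
    (hN : ∀ z, vnorm (N *ᵥ z) ≤ t * vnorm z)
    (htop : IsTopREigenBasis
      ((Us * B * diagonal D + N) * (Us * B * diagonal D + N)ᵀ) U) :
    SD Us U ^ 2 ≤ r * t ^ 2 / (c * σ / 4) ^ 2 := by
  refine SD_sq_le_of_topR (by positivity) hUs htop (fun w => ?_) (fun z => ?_)
  · have e1 : (Us * B * diagonal D + N)ᵀ *ᵥ (Us *ᵥ w) =
        diagonal D *ᵥ (Bᵀ *ᵥ w) + Nᵀ *ᵥ (Us *ᵥ w) := by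
      rw [transpose_add, add_mulVec, transpose_mul, transpose_mul, diagonal_transpose]
      congr 1
      rw [mulVec_mulVec, mulVec_mulVec, Matrix.mul_assoc, Matrix.mul_assoc, hUs, Matrix.mul_one]
    rw [e1, ← vnorm_sq, ← vnorm_sq, ← mul_pow]
    refine pow_le_pow_left₀ (mul_nonneg (by positivity) (vnorm_nonneg w)) ?_ 2
    have h1 : vnorm (Nᵀ *ᵥ (Us *ᵥ w)) ≤ t * vnorm w := by
      have := vnorm_transpose_mulVec_le ht hN (Us *ᵥ w)
      rwa [vnorm_orthonormal_mulVec hUs] at this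
    have hcol : ∀ k, ((Bᵀ *ᵥ w) k) ^ 2 ≤ M * vnorm w ^ 2 := by
      intro k
      have a1 : (Bᵀ *ᵥ w) k = matCol B k ⬝ᵥ w := rfl
      have a2 := dotProduct_le_vnorm_mul_vnorm (matCol B k) w
      have a3 := dotProduct_le_vnorm_mul_vnorm (-matCol B k) w
      have a4 : vnorm (-matCol B k) = vnorm (matCol B k) := by simp [vnorm]
      rw [neg_dotProduct, a4] at a3
      rw [a1]
      calc (matCol B k ⬝ᵥ w) ^ 2 ≤ (vnorm (matCol B k) * vnorm w) ^ 2 :=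
            sq_le_sq' (by linarith) a2
        _ = vnorm (matCol B k) ^ 2 * vnorm w ^ 2 := mul_pow _ _ _
        _ ≤ _ := by gcongr; exact hM k
    have h2 : c * σ / 2 * vnorm w ≤ vnorm (diagonal D *ᵥ (Bᵀ *ᵥ w)) := by
      refine abs_le_of_sq_le_sq' ?_ (vnorm_nonneg _) |>.2
      have b1 : vnorm (diagonal D *ᵥ (Bᵀ *ᵥ w)) ^ 2 = ∑ k, D k ^ 2 * ((Bᵀ *ᵥ w) k) ^ 2 := by
        rw [vnorm_sq, dotProduct]
        refine Finset.sum_congr rfl fun k _ => ?_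
        rw [mulVec_diagonal]; ring
      have b2 : ∑ k, c ^ 2 * ((Bᵀ *ᵥ w) k) ^ 2 ≤
          ∑ k, (D k ^ 2 * ((Bᵀ *ᵥ w) k) ^ 2 +
            if k ∈ bad then c ^ 2 * (M * vnorm w ^ 2) else 0) := by
        refine Finset.sum_le_sum fun k _ => ?_
        split_ifs with hk
        · have := mul_le_mul_of_nonneg_left (hcol k) (sq_nonneg c)
          have := mul_nonneg (sq_nonneg (D k)) (sq_nonneg ((Bᵀ *ᵥ w) k))
          linarith
        · have : c ^ 2 ≤ D k ^ 2 := pow_le_pow_left₀ hc.le (hD k hk) 2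
          rw [add_zero]
          gcongr
      rw [Finset.sum_add_distrib, ← b1, Finset.sum_ite_mem, Finset.univ_inter, Finset.sum_const,
        nsmul_eq_mul, ← Finset.mul_sum] at b2
      have b3 : vnorm (Bᵀ *ᵥ w) ^ 2 = ∑ k, ((Bᵀ *ᵥ w) k) ^ 2 := by
        rw [vnorm_sq, dotProduct]
        exact Finset.sum_congr rfl fun k _ => (pow_two _).symm
      have b4 : (σ * vnorm w) ^ 2 ≤ vnorm (Bᵀ *ᵥ w) ^ 2 :=
        pow_le_pow_left₀ (mul_nonneg hσ.le (vnorm_nonneg w)) (hB w) 2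
      have b5 : (bad.card : ℝ) * (c ^ 2 * (M * vnorm w ^ 2)) ≤
          c ^ 2 * vnorm w ^ 2 * (σ ^ 2 / 2) := by
        calc _ = c ^ 2 * vnorm w ^ 2 * (M * bad.card) := by ring
          _ ≤ _ := by gcongr
      rw [← b3] at b2
      have b6 := mul_le_mul_of_nonneg_left b4 (sq_nonneg c)
      have b7 : 0 ≤ c ^ 2 * σ ^ 2 * vnorm w ^ 2 := by positivity
      nlinarith
    have h3 : vnorm (diagonal D *ᵥ (Bᵀ *ᵥ w)) ≤
        vnorm (diagonal D *ᵥ (Bᵀ *ᵥ w) + Nᵀ *ᵥ (Us *ᵥ w)) + vnorm (Nᵀ *ᵥ (Us *ᵥ w)) := by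
      have e : ∀ v : Fin q → ℝ, vnorm v = ‖(WithLp.toLp 2 v : EuclideanSpace ℝ (Fin q))‖ :=
        fun v => vnorm_ofLp (WithLp.toLp 2 v)
      rw [e, e, e, WithLp.toLp_add]
      exact norm_le_add_norm_add _ _
    have h4 := mul_le_mul_of_nonneg_right htc (vnorm_nonneg w)
    linarith
  · have e1 : (1 - Us * Usᵀ) *ᵥ ((Us * B * diagonal D + N) *ᵥ z) = (1 - Us * Usᵀ) *ᵥ (N *ᵥ z) := by
      have : (1 - Us * Usᵀ) * (Us * B * diagonal D) = 0 := by
        have h0 : (1 - Us * Usᵀ) * Us = 0 := by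
          rw [Matrix.sub_mul, Matrix.one_mul, Matrix.mul_assoc, hUs, Matrix.mul_one, sub_self]
        rw [Matrix.mul_assoc Us, ← Matrix.mul_assoc, h0, Matrix.zero_mul]
      rw [add_mulVec, mulVec_add, mulVec_mulVec, this, zero_mulVec, zero_add]
    rw [e1]
    refine (proj_dotProduct_le hUs _).trans ?_
    rw [← vnorm_sq, ← vnorm_sq, ← mul_pow]
    exact pow_le_pow_left₀ (vnorm_nonneg _) (hN z) 2

lemma sum_vnorm_matCol_sq {r q : ℕ} (B : Matrix (Fin r) (Fin q) ℝ) :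
    ∑ k, vnorm (matCol B k) ^ 2 = ∑ j, vnorm (Bᵀ *ᵥ Pi.single j 1) ^ 2 := by
  have h1 : ∀ k, vnorm (matCol B k) ^ 2 = ∑ j, B j k ^ 2 := fun k => by
    rw [vnorm_sq, dotProduct]
    exact Finset.sum_congr rfl fun j _ => (pow_two _).symm
  have h2 : ∀ j, vnorm (Bᵀ *ᵥ Pi.single j 1) ^ 2 = ∑ k, B j k ^ 2 := fun j => by
    rw [mulVec_single_one, vnorm_sq, dotProduct]
    exact Finset.sum_congr rfl fun k _ => (pow_two _).symm
  simp_rw [h1, h2]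
  exact Finset.sum_comm

lemma vnorm_single_one {r : ℕ} (j : Fin r) : vnorm (Pi.single j (1 : ℝ)) = 1 := by
  rw [vnorm_eq_one]
  simp

lemma exists_unit_smul_eq {n : ℕ} (hn : 0 < n) (x : Fin n → ℝ) :
    ∃ u : Fin n → ℝ, u ⬝ᵥ u = 1 ∧ x = vnorm x • u := by
  by_cases hx : x = 0
  · exact ⟨Pi.single ⟨0, hn⟩ 1, by simp, by simp [hx, vnorm]⟩
  · refine ⟨(vnorm x)⁻¹ • x, ?_, ?_⟩
    · rw [← vnorm_sq, vnorm_normalize hx, one_pow]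
    · rw [smul_smul, mul_inv_cancel₀ (vnorm_pos hx).ne', one_smul]

lemma vnorm_matCol_mul {n r q : ℕ} {U : Matrix (Fin n) (Fin r) ℝ} (hU : Uᵀ * U = 1)
    (B : Matrix (Fin r) (Fin q) ℝ) (k : Fin q) :
    vnorm (matCol (U * B) k) = vnorm (matCol B k) :=
  vnorm_orthonormal_mulVec hU (matCol B k)

/-- If few columns have atypically small energy, the total energy is bounded below. -/
lemma mul_le_sum_sum_sq {q m : ℕ} {ρ : Fin q → ℝ} {ζ : Fin q → Fin m → ℝ} {c M S : ℝ}
    (hc : 0 ≤ c) (hM : ∀ k, ρ k ^ 2 ≤ M) (bad : Finset (Fin q)) (hS : S ≤ ∑ k, ρ k ^ 2)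
    (hbad : M * bad.card ≤ S / 2) (hgood : ∀ k, k ∉ bad → c * m ≤ ∑ i, ζ k i ^ 2) :
    c * m * (S / 2) ≤ ∑ k, ∑ i, (ρ k * ζ k i) ^ 2 := by
  have h1 : ∑ k, c * m * ρ k ^ 2 ≤
      ∑ k, (∑ i, (ρ k * ζ k i) ^ 2 + if k ∈ bad then c * m * M else 0) := by
    refine Finset.sum_le_sum fun k _ => ?_
    have e : ∑ i, (ρ k * ζ k i) ^ 2 = ρ k ^ 2 * ∑ i, ζ k i ^ 2 := by
      rw [Finset.mul_sum]; exact Finset.sum_congr rfl fun i _ => mul_pow _ _ _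
    rw [e]
    split_ifs with hk
    · have : c * m * ρ k ^ 2 ≤ c * m * M := by gcongr; exact hM k
      have : 0 ≤ ρ k ^ 2 * ∑ i, ζ k i ^ 2 := by positivity
      linarith
    · have := mul_le_mul_of_nonneg_left (hgood k hk) (sq_nonneg (ρ k))
      linarith
  rw [Finset.sum_add_distrib, Finset.sum_ite_mem, Finset.univ_inter, Finset.sum_const,
    nsmul_eq_mul, ← Finset.mul_sum] at h1
  have hcm : 0 ≤ c * m := by positivity
  have h2 := mul_le_mul_of_nonneg_left hbad hcm
  have h3 := mul_le_mul_of_nonneg_left hS hcm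
  linarith

/-- Conclusion of the initialization theorem on the intersection of the good events. -/
lemma SD_le_of_good_events {n q r m : ℕ} (hr : 0 < r) (hq : 0 < q) (hm : 0 < m)
    {Us : Matrix (Fin n) (Fin r) ℝ} {B : Matrix (Fin r) (Fin q) ℝ} {u : Fin q → Fin n → ℝ}
    (hUs : Usᵀ * Us = 1) (hu : ∀ k, u k ⬝ᵥ u k = 1)
    {ρ : Fin q → ℝ} (hX : ∀ k, matCol (Us * B) k = ρ k • u k) {κ μ σ c₁ c₂ δ t a : ℝ}
    (hρB : ∀ k, ρ k = vnorm (matCol B k))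
    (hκ : 1 ≤ κ) (hμ : 1 ≤ μ) (hσ : 0 < σ) (hc₁ : 0 < c₁) (hc₂ : 0 < c₂) (hδ0 : 0 < δ) (hδ1 : δ ≤ 1)
    (hB : ∀ w, σ * vnorm w ≤ vnorm (Bᵀ *ᵥ w))
    (hF1 : r * σ ^ 2 ≤ ∑ k, ρ k ^ 2) (hF2 : ∑ k, ρ k ^ 2 ≤ r * (κ * σ) ^ 2)
    (hM : ∀ k, ρ k ^ 2 ≤ μ ^ 2 * (κ * σ) ^ 2 * (r / q))
    (ht : t = c₂ * σ * δ / (4 * Real.sqrt r)) (ha : a = 36 * κ ^ 4 * μ ^ 2 * r * σ ^ 2 / q)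
    (ζ : Fin q → Fin m → ℝ) (ω : Fin q → Fin m → Fin n → ℝ) (bad₁ bad₂ : Finset (Fin q))
    (hb₁ : (bad₁.card : ℝ) < q / (2 * μ ^ 2 * κ ^ 2 * r))
    (hb₂ : (bad₂.card : ℝ) < q / (2 * μ ^ 2 * κ ^ 2 * r))
    (hgood₁ : ∀ k, k ∉ bad₁ → c₁ * m ≤ ∑ i, ζ k i ^ 2)
    (hgood₂ : ∀ k, k ∉ bad₂ → c₂ * m ≤ ∑ i, ζ k i ^ 2 * (if ζ k i ^ 2 ≤ c₁ then 1 else 0))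
    (hsum : ∑ k, ∑ i, (ρ k * ζ k i) ^ 2 < 4 * m * ∑ k, ρ k ^ 2)
    (hN : ∀ z, vnorm (noiseMat ρ u (min (9 * κ ^ 2 * μ ^ 2 *
      ((∑ k, ∑ i, (ρ k * ζ k i) ^ 2) / ((m : ℝ) * q))) a) ζ ω *ᵥ z) ≤ t * vnorm z)
    {U : Matrix (Fin n) (Fin r) ℝ}
    (htop : IsTopREigenBasis
      (initMat (fun k => matCol (Us * B) k)
          (initAlpha (fun k => matCol (Us * B) k) (9 * κ ^ 2 * μ ^ 2) (gaussSplit u (ζ, ω)))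
          (gaussSplit u (ζ, ω)) *
        (initMat (fun k => matCol (Us * B) k)
          (initAlpha (fun k => matCol (Us * B) k) (9 * κ ^ 2 * μ ^ 2) (gaussSplit u (ζ, ω)))
          (gaussSplit u (ζ, ω)))ᵀ) U) :
    SD Us U ≤ δ := by
  have hr' : (1 : ℝ) ≤ r := by exact_mod_cast hr
  have hq' : (0 : ℝ) < q := by exact_mod_cast hq
  have hm' : (0 : ℝ) < m := by exact_mod_cast hm
  have hμ0 : 0 < μ := by linarith
  have hκ0 : 0 < κ := by linarith
  have hr0 : (0 : ℝ) < r := by linarith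
  set Y := ∑ k, ∑ i, (ρ k * ζ k i) ^ 2 with hY
  set α := 9 * κ ^ 2 * μ ^ 2 * (Y / ((m : ℝ) * q)) with hα
  set M := μ ^ 2 * (κ * σ) ^ 2 * (r / q) with hMdef
  have hM0 : 0 < M := by positivity
  have hMb : M * (q / (2 * μ ^ 2 * κ ^ 2 * r)) = σ ^ 2 / 2 := by
    rw [hMdef]; field_simp
  have hbad₁ : M * bad₁.card ≤ σ ^ 2 / 2 := by rw [← hMb]; gcongr
  have hbad₂ : M * bad₂.card ≤ σ ^ 2 / 2 := by rw [← hMb]; gcongr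
  have hσr : σ ^ 2 ≤ r * σ ^ 2 := le_mul_of_one_le_left (sq_nonneg σ) hr'
  have hYlow : c₁ * m * (r * σ ^ 2 / 2) ≤ Y :=
    mul_le_sum_sum_sq hc₁.le hM bad₁ hF1 (by linarith) hgood₁
  have hαlow : c₁ * M ≤ α := by
    have e : 9 * κ ^ 2 * μ ^ 2 * (c₁ * m * (r * σ ^ 2 / 2) / ((m : ℝ) * q)) = 9 / 2 * (c₁ * M) := by
      rw [hMdef]; field_simp
    have : 9 * κ ^ 2 * μ ^ 2 * (c₁ * m * (r * σ ^ 2 / 2) / ((m : ℝ) * q)) ≤ α := by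
      rw [hα]; gcongr
    have : 0 < c₁ * M := by positivity
    linarith
  have hαup : α ≤ a := by
    have e : 9 * κ ^ 2 * μ ^ 2 * (4 * m * (r * (κ * σ) ^ 2) / ((m : ℝ) * q)) = a := by
      rw [ha]; field_simp; ring
    rw [← e, hα]
    have : Y ≤ 4 * m * (r * (κ * σ) ^ 2) := hsum.le.trans (by gcongr)
    gcongr
  rw [min_eq_left hαup] at hN
  rw [initAlpha_gaussSplit hu hX, initMat_gaussSplit hu hX] at htop
  have hsr : 0 < Real.sqrt r := Real.sqrt_pos.mpr hr0
  have hsr1 : 1 ≤ Real.sqrt r := Real.one_le_sqrt.mpr hr'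
  have ht0 : 0 ≤ t := by rw [ht]; positivity
  have htc : t ≤ c₂ * σ / 4 := by
    rw [ht, div_le_div_iff₀ (by positivity) (by norm_num)]
    have : c₂ * σ * δ ≤ c₂ * σ * Real.sqrt r := by gcongr; linarith
    linarith
  have h := SD_sq_le_of_signal_add_noise (M := M) hUs hσ hc₂ ht0 htc hB
    (fun k => by rw [← hρB]; exact hM k) bad₂ hbad₂ (fun k hk => ?_) hN htop
  · have e : r * t ^ 2 / (c₂ * σ / 4) ^ 2 = δ ^ 2 := by
      rw [ht, div_pow, mul_pow 4, Real.sq_sqrt hr0.le]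
      field_simp
    rw [e] at h
    exact abs_le_of_sq_le_sq' h hδ0.le |>.2
  · have h1 : c₂ = 1 / m * (c₂ * m) := by field_simp
    rw [h1]
    refine mul_le_mul_of_nonneg_left ((hgood₂ k hk).trans ?_) (by positivity)
    refine Finset.sum_le_sum fun i _ => ?_
    refine mul_le_mul_of_nonneg_left ?_ (sq_nonneg _)
    by_cases h2 : ζ k i ^ 2 ≤ c₁
    · have h3 : (ρ k * ζ k i) ^ 2 ≤ α := by
        rw [mul_pow]
        calc _ ≤ M * c₁ := by gcongr; exact hM k
          _ ≤ α := by linarith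
      rw [if_pos h2]
      exact le_of_eq (if_pos h3).symm
    · rw [if_neg h2]
      split_ifs <;> norm_num

lemma measurable_noiseMat {n q m : ℕ} (ρ : Fin q → ℝ) (u : Fin q → Fin n → ℝ)
    {β : (Fin q → Fin m → ℝ) → ℝ} (hβ : Measurable β) (j : Fin n) (k : Fin q) :
    Measurable fun p : (Fin q → Fin m → ℝ) × (Fin q → Fin m → Fin n → ℝ) =>
      noiseMat ρ u (β p.1) p.1 p.2 j k := by
  simp only [noiseMat, Matrix.of_apply, Pi.sub_apply, Pi.smul_apply, smul_eq_mul, dotProduct]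
  refine Measurable.const_mul (Finset.measurable_fun_sum _ fun i _ => Measurable.mul ?_ ?_) _
  · fun_prop
  · refine Measurable.mul (by fun_prop) (Measurable.ite ?_ measurable_const measurable_const)
    exact measurableSet_le (by fun_prop) (hβ.comp measurable_fst)

/-- The noise matrix truncated at any level `β ≤ a` is bounded by `t` up to an exponentially small
probability. -/
lemma measure_noiseMat_not_bounded_le {n q m : ℕ} (hm : 0 < m) (ρ : Fin q → ℝ)
    {u : Fin q → Fin n → ℝ} (hu : ∀ k, u k ⬝ᵥ u k = 1) {β : (Fin q → Fin m → ℝ) → ℝ}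
    (hβ : Measurable β) {a t : ℝ} (ha : 0 < a) (hβa : ∀ ζ, β ζ ≤ a) (ht : 0 ≤ t) :
    ((Measure.pi fun _ : Fin q => Measure.pi fun _ : Fin m => stdGaussian).prod
        (gaussianMatrices q m n))
      {p | ¬ ∀ z, vnorm (noiseMat ρ u (β p.1) p.1 p.2 *ᵥ z) ≤ t * vnorm z} ≤
      ENNReal.ofReal (4 ^ (n + q) * Real.exp (-(t ^ 2 * m / (128 * a)))) := by
  have hm' : (0 : ℝ) < m := by exact_mod_cast hm
  have hl : 0 ≤ t * m / (8 * a) := by positivity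
  have hmeas := measurable_noiseMat ρ u hβ
  refine (measure_not_bounded_le _ hmeas hl ht
    (K := (t * m / (8 * a)) ^ 2 * a / (2 * m)) fun w z hw hz => ?_).trans (le_of_eq ?_)
  · rw [lintegral_prod _ ?_]
    · refine (lintegral_mono fun ζ =>
        lintegral_exp_noiseMat_le hm hu ha.le (hβa ζ) ζ _ hw hz).trans ?_
      simp
    · refine Measurable.aemeasurable ?_
      simp only [dotProduct, mulVec]
      refine ENNReal.measurable_ofReal.comp (Real.measurable_exp.comp (Measurable.const_mul ?_ _))
      refine Finset.measurable_fun_sum _ fun i _ => Measurable.const_mul ?_ _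
      exact Finset.measurable_fun_sum _ fun j _ => Measurable.mul_const (hmeas i j) _
  · congr 3
    field_simp
    ring

lemma measurable_SD {n r : ℕ} {Ω : Type*} [MeasurableSpace Ω] (Us : Matrix (Fin n) (Fin r) ℝ)
    {U : Ω → Matrix (Fin n) (Fin r) ℝ} (hU : ∀ i j, Measurable fun ω => U ω i j) :
    Measurable fun ω => SD Us (U ω) := by
  simp only [SD, frob, mul_apply]
  refine Real.continuous_sqrt.measurable.comp ?_
  refine Finset.measurable_fun_sum _ fun i _ => Finset.measurable_fun_sum _ fun j _ => ?_
  refine Measurable.pow_const (Finset.measurable_fun_sum _ fun k _ => ?_) 2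
  exact Measurable.const_mul (hU k j) _

lemma measure_compl_SD_le {n q r m : ℕ} (hr : 0 < r) (hn : 0 < n) (hq : 0 < q) (hm : 0 < m)
    {Us : Matrix (Fin n) (Fin r) ℝ} {B : Matrix (Fin r) (Fin q) ℝ} (hUs : Usᵀ * Us = 1)
    {κ μ σ c₁ c₂ δ C : ℝ} (hκ : 1 ≤ κ) (hμ : 1 ≤ μ) (hσ : 0 < σ) (hc₁ : 0 < c₁) (hc₂ : 0 < c₂)
    (hδ0 : 0 < δ) (hδ1 : δ ≤ 1)
    (hi₁ : ∫⁻ z, ENNReal.ofReal (Real.exp (-(z ^ 2))) ∂stdGaussian ≤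
      ENNReal.ofReal (Real.exp (-(2 * c₁))))
    (hi₂ : ∫⁻ z, ENNReal.ofReal (Real.exp (-(z ^ 2 * (if z ^ 2 ≤ c₁ then 1 else 0)))) ∂stdGaussian ≤
      ENNReal.ofReal (Real.exp (-(2 * c₂))))
    (hB : ∀ w, σ * vnorm w ≤ vnorm (Bᵀ *ᵥ w)) (hB' : ∀ w, vnorm (Bᵀ *ᵥ w) ≤ κ * σ * vnorm w)
    (hM : ∀ k, vnorm (matCol B k) ^ 2 ≤ μ ^ 2 * (κ * σ) ^ 2 * (r / q))
    (hC6 : 6 ≤ C) (hC₁ : 8 ≤ c₁ * C) (hC₂ : 8 ≤ c₂ * C) (hC : 5 * 73728 ≤ c₂ ^ 2 * C)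
    (hmq : C * κ ^ 4 * μ ^ 2 * ((n : ℝ) + q) * r ^ 2 / δ ^ 2 ≤ (m : ℝ) * q)
    {U₀ : (Fin q → Fin m → Fin n → ℝ) → Matrix (Fin n) (Fin r) ℝ}
    (hU₀ : ∀ i j, Measurable fun ω => U₀ ω i j)
    (htop : ∀ ω, IsTopREigenBasis
          (initMat (fun k => matCol (Us * B) k)
              (initAlpha (fun k => matCol (Us * B) k) (9 * κ ^ 2 * μ ^ 2) ω) ω *
            (initMat (fun k => matCol (Us * B) k)
              (initAlpha (fun k => matCol (Us * B) k) (9 * κ ^ 2 * μ ^ 2) ω) ω)ᵀ)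
          (U₀ ω)) :
    gaussianMatrices q m n {ω | SD Us (U₀ ω) ≤ δ}ᶜ ≤
      4 * ENNReal.ofReal (Real.exp (-(3 * ((n : ℝ) + q)))) := by
  classical
  have hr' : (1 : ℝ) ≤ r := by exact_mod_cast hr
  have hr0 : (0 : ℝ) < r := by linarith
  have hq' : (0 : ℝ) < q := by exact_mod_cast hq
  have hn' : (0 : ℝ) < n := by exact_mod_cast hn
  have hm' : (0 : ℝ) < m := by exact_mod_cast hm
  have hμ0 : 0 < μ := by linarith
  have hκ0 : 0 < κ := by linarith
  set s : ℝ := (n : ℝ) + q with hs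
  have hs0 : 0 < s := by positivity
  have hqs : (q : ℝ) ≤ s := by linarith
  have hC0 : 0 < C := by linarith
  choose u hu hXu using fun k => exists_unit_smul_eq hn (matCol (Us * B) k)
  set ρ : Fin q → ℝ := fun k => vnorm (matCol (Us * B) k) with hρ
  have hρB : ∀ k, ρ k = vnorm (matCol B k) := fun k => vnorm_matCol_mul hUs B k
  have hM' : ∀ k, ρ k ^ 2 ≤ μ ^ 2 * (κ * σ) ^ 2 * (r / q) := fun k => by rw [hρB]; exact hM k
  have hsumρ : ∑ k, ρ k ^ 2 = ∑ j, vnorm (Bᵀ *ᵥ Pi.single j 1) ^ 2 := by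
    rw [← sum_vnorm_matCol_sq]
    exact Finset.sum_congr rfl fun k _ => by rw [hρB]
  have hF1 : r * σ ^ 2 ≤ ∑ k, ρ k ^ 2 := by
    rw [hsumρ]
    have : ∑ _j : Fin r, σ ^ 2 ≤ ∑ j : Fin r, vnorm (Bᵀ *ᵥ Pi.single j 1) ^ 2 := by
      refine Finset.sum_le_sum fun j _ => pow_le_pow_left₀ hσ.le ?_ 2
      have := hB (Pi.single j 1)
      rwa [vnorm_single_one, mul_one] at this
    simpa using this
  have hF2 : ∑ k, ρ k ^ 2 ≤ r * (κ * σ) ^ 2 := by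
    rw [hsumρ]
    have : ∑ j : Fin r, vnorm (Bᵀ *ᵥ Pi.single j 1) ^ 2 ≤ ∑ _j : Fin r, (κ * σ) ^ 2 := by
      refine Finset.sum_le_sum fun j _ => pow_le_pow_left₀ (vnorm_nonneg _) ?_ 2
      have := hB' (Pi.single j 1)
      rwa [vnorm_single_one, mul_one] at this
    simpa using this
  have hbig : C * s ≤ m * q * δ ^ 2 / (κ ^ 4 * μ ^ 2 * r ^ 2) := by
    rw [le_div_iff₀ (by positivity)]
    rw [div_le_iff₀ (by positivity)] at hmq
    linarith
  have hbig' : C * s ≤ m * q / (κ ^ 2 * μ ^ 2 * r) := by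
    refine hbig.trans ?_
    have e : m * q / (κ ^ 2 * μ ^ 2 * r) = m * q * (κ ^ 2 * r) / (κ ^ 4 * μ ^ 2 * r ^ 2) := by
      field_simp
    rw [e]
    have h1 : δ ^ 2 ≤ 1 := pow_le_one₀ hδ0.le hδ1
    have h2 : 1 ≤ κ ^ 2 * r := one_le_mul_of_one_le_of_one_le (one_le_pow₀ hκ) hr'
    gcongr
    linarith
  set b : ℝ := q / (2 * μ ^ 2 * κ ^ 2 * r) with hb
  have hmb : (m : ℝ) * b = m * q / (κ ^ 2 * μ ^ 2 * r) / 2 := by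
    rw [hb]; field_simp
  set t : ℝ := c₂ * σ * δ / (4 * Real.sqrt r) with ht
  set a : ℝ := 36 * κ ^ 4 * μ ^ 2 * r * σ ^ 2 / q with ha
  have ht0 : 0 ≤ t := by positivity
  have ha0 : 0 < a := by positivity
  set β : (Fin q → Fin m → ℝ) → ℝ := fun ζ => min (9 * κ ^ 2 * μ ^ 2 *
      ((∑ k, ∑ i, (ρ k * ζ k i) ^ 2) / ((m : ℝ) * q))) a with hβ
  have hβm : Measurable β := by fun_prop
  set g₂ : ℝ → ℝ := fun z => z ^ 2 * (if z ^ 2 ≤ c₁ then 1 else 0) with hg₂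
  have hg₂m : Measurable g₂ := Measurable.mul (by fun_prop)
    (Measurable.ite (measurableSet_le (by fun_prop) measurable_const)
      measurable_const measurable_const)
  set S₁ : Set (Fin m → ℝ) := {x | ∑ i, x i ^ 2 < c₁ * m} with hS₁
  set S₂ : Set (Fin m → ℝ) := {x | ∑ i, g₂ (x i) < c₂ * m} with hS₂
  have hS₁m : MeasurableSet S₁ := measurableSet_lt (by fun_prop) measurable_const
  have hS₂m : MeasurableSet S₂ := measurableSet_lt (by fun_prop) measurable_const
  set ν := Measure.pi fun _ : Fin q => Measure.pi fun _ : Fin m => stdGaussian with hν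
  have hcount : ∀ (S : Set (Fin m → ℝ)) (c : ℝ), 0 < c → MeasurableSet S → 8 ≤ c * C →
      (Measure.pi fun _ : Fin m => stdGaussian) S ≤ ENNReal.ofReal (Real.exp (-(c * m))) →
      ν {ζ | b ≤ ((Finset.univ.filter fun k => ζ k ∈ S).card : ℝ)} ≤
        ENNReal.ofReal (Real.exp (-(3 * s))) := by
    intro S c hc hS hcC hP
    refine (measure_count_ge_le _ hS hP q b (by positivity)).trans ?_
    refine ENNReal.ofReal_le_ofReal ?_
    have h2 : (2 : ℝ) ^ q ≤ Real.exp q := by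
      rw [← mul_one (q : ℝ), Real.exp_nat_mul]
      have := Real.add_one_le_exp 1
      gcongr
      linarith
    calc _ ≤ Real.exp q * Real.exp (-(c * m * b)) := by gcongr
      _ = Real.exp (q - c * m * b) := by rw [← Real.exp_add]; ring_nf
      _ ≤ _ := by
        refine Real.exp_le_exp.mpr ?_
        have h3 : c * (C * s) / 2 ≤ c * m * b := by
          rw [mul_assoc c (m : ℝ) b, hmb]
          have := mul_le_mul_of_nonneg_left hbig' hc.le
          linarith
        have h4 := mul_le_mul_of_nonneg_right hcC hs0.le
        linarith
  have hE₁ := hcount S₁ c₁ hc₁ hS₁m hC₁ (measure_sum_lt_le (h := fun z => z ^ 2) (by fun_prop) hi₁ m)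
  have hE₂ := hcount S₂ c₂ hc₂ hS₂m hC₂ (measure_sum_lt_le hg₂m hi₂ m)
  have hE₃ : ν {ζ | 4 * m * ∑ k, ρ k ^ 2 ≤ ∑ k, ∑ i, (ρ k * ζ k i) ^ 2} ≤
      ENNReal.ofReal (Real.exp (-(3 * s))) := by
    set M := μ ^ 2 * (κ * σ) ^ 2 * (r / q) with hMdef
    have hM0 : 0 < M := by positivity
    refine (measure_sum_sq_ge_le (l := 1 / (4 * M)) (by positivity) fun k => ?_).trans ?_
    · rw [div_mul_eq_mul_div, one_mul, div_le_div_iff₀ (by positivity) (by norm_num)]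
      linarith [hM' k]
    · refine ENNReal.ofReal_le_ofReal (Real.exp_le_exp.mpr (neg_le_neg ?_))
      have h1 : 2 * (1 / (4 * M)) * m * (r * σ ^ 2) ≤ 2 * (1 / (4 * M)) * m * ∑ k, ρ k ^ 2 := by
        gcongr
      have h2 : 2 * (1 / (4 * M)) * m * (r * σ ^ 2) = m * q / (κ ^ 2 * μ ^ 2 * r) / 2 * r := by
        rw [hMdef]; field_simp; norm_num
      have h3 : m * q / (κ ^ 2 * μ ^ 2 * r) / 2 ≤ m * q / (κ ^ 2 * μ ^ 2 * r) / 2 * r :=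
        le_mul_of_one_le_right (by positivity) hr'
      have h4 := mul_le_mul_of_nonneg_right hC6 hs0.le
      linarith
  have hE₄ : (ν.prod (gaussianMatrices q m n))
      {p | ¬ ∀ z, vnorm (noiseMat ρ u (β p.1) p.1 p.2 *ᵥ z) ≤ t * vnorm z} ≤
      ENNReal.ofReal (Real.exp (-(3 * s))) := by
    refine (measure_noiseMat_not_bounded_le hm ρ hu hβm ha0 (fun ζ => min_le_right _ _) ht0).trans ?_
    refine ENNReal.ofReal_le_ofReal ?_
    have h4 : (4 : ℝ) ^ (n + q) ≤ Real.exp (2 * s) := by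
      have e : 2 * s = ((n + q : ℕ) : ℝ) * 2 := by rw [hs]; push_cast; ring
      rw [e, Real.exp_nat_mul]
      have h1 := Real.add_one_le_exp 1
      have h2 : Real.exp 2 = Real.exp 1 * Real.exp 1 := by rw [← Real.exp_add]; norm_num
      gcongr
      rw [h2]
      nlinarith
    calc _ ≤ Real.exp (2 * s) * Real.exp (-(t ^ 2 * m / (128 * a))) := by gcongr
      _ = Real.exp (2 * s - t ^ 2 * m / (128 * a)) := by rw [← Real.exp_add]; ring_nf
      _ ≤ _ := by
        refine Real.exp_le_exp.mpr ?_
        have e : t ^ 2 * m / (128 * a) =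
            c₂ ^ 2 * (m * q * δ ^ 2 / (κ ^ 4 * μ ^ 2 * r ^ 2)) / 73728 := by
          rw [ht, ha, div_pow, mul_pow 4, Real.sq_sqrt hr0.le]
          field_simp
          norm_num
        have h1 := mul_le_mul_of_nonneg_left hbig (sq_nonneg c₂)
        have h2 := mul_le_mul_of_nonneg_right hC hs0.le
        rw [e]
        linarith
  have hmeas : MeasurableSet {ω | SD Us (U₀ ω) ≤ δ}ᶜ :=
    (measurableSet_le (measurable_SD Us hU₀) measurable_const).compl
  rw [← (measurePreserving_gaussSplit hu).measure_preimage hmeas.nullMeasurableSet]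
  have hfst : ∀ E : Set (Fin q → Fin m → ℝ), ν E ≤ ENNReal.ofReal (Real.exp (-(3 * s))) →
      (ν.prod (gaussianMatrices q m n)) (E ×ˢ Set.univ) ≤
        ENNReal.ofReal (Real.exp (-(3 * s))) := by
    intro E hE
    rwa [Measure.prod_prod, measure_univ, mul_one]
  have hsub : gaussSplit u ⁻¹' {ω | SD Us (U₀ ω) ≤ δ}ᶜ ⊆
      (({ζ | b ≤ ((Finset.univ.filter fun k => ζ k ∈ S₁).card : ℝ)} ×ˢ Set.univ) ∪
        ({ζ | b ≤ ((Finset.univ.filter fun k => ζ k ∈ S₂).card : ℝ)} ×ˢ Set.univ)) ∪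
      (({ζ | 4 * m * ∑ k, ρ k ^ 2 ≤ ∑ k, ∑ i, (ρ k * ζ k i) ^ 2} ×ˢ Set.univ) ∪
        {p | ¬ ∀ z, vnorm (noiseMat ρ u (β p.1) p.1 p.2 *ᵥ z) ≤ t * vnorm z}) := by
    intro p hp
    by_contra hcon
    simp only [Set.mem_union, Set.mem_prod, Set.mem_ofPred_eq, Set.mem_univ, and_true, not_or,
      not_le, not_not] at hcon
    obtain ⟨⟨k₁, k₂⟩, k₃, k₄⟩ := hcon
    refine hp ?_
    exact SD_le_of_good_events hr hq hm hUs hu hXu hρB hκ hμ hσ hc₁ hc₂ hδ0 hδ1 hB hF1 hF2 hM'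
      ht ha p.1 p.2 _ _ k₁ k₂ (fun k hk => by simpa [hS₁] using hk)
      (fun k hk => by
        rw [Finset.mem_filter, hS₂, Set.mem_ofPred_eq] at hk
        push Not at hk
        exact hk (Finset.mem_univ k)) k₃ k₄ (htop _)
  refine (measure_mono hsub).trans ((measure_union_le _ _).trans ?_)
  refine (add_le_add ((measure_union_le _ _).trans (add_le_add (hfst _ hE₁) (hfst _ hE₂)))
    ((measure_union_le _ _).trans (add_le_add (hfst _ hE₃) hE₄))).trans (le_of_eq ?_)
  ring

/-- **Theorem 3.1** (Initialization): truncated spectral initialization of AltGD-Min. -/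
theorem thm31_initialization :
    ∃ c C : ℝ, 0 < c ∧ 0 < C ∧
    ∀ (n q r m : ℕ) (Ustar : Matrix (Fin n) (Fin r) ℝ) (Btil : Matrix (Fin r) (Fin q) ℝ)
      (μ δ₀ σp σm κ : ℝ),
      Ustarᵀ * Ustar = 1 → Btil.rank = r →
      σp = spec (Ustar * Btil) → σm = sigMin Btil → κ = σp / σm →
      1 ≤ μ → (∀ k, vnorm (matCol Btil k) ≤ μ * σp * Real.sqrt ((r : ℝ) / q)) →
      0 < δ₀ → δ₀ < 0.1 →
      C * κ ^ 4 * μ ^ 2 * ((n : ℝ) + q) * r ^ 2 / δ₀ ^ 2 ≤ (m : ℝ) * q →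
      ∀ U₀ : (Fin q → Fin m → Fin n → ℝ) → Matrix (Fin n) (Fin r) ℝ,
        (∀ i j, Measurable fun ω => U₀ ω i j) →
        (∀ ω, IsTopREigenBasis
          (initMat (fun k => matCol (Ustar * Btil) k)
              (initAlpha (fun k => matCol (Ustar * Btil) k) (9 * κ ^ 2 * μ ^ 2) ω) ω *
            (initMat (fun k => matCol (Ustar * Btil) k)
              (initAlpha (fun k => matCol (Ustar * Btil) k) (9 * κ ^ 2 * μ ^ 2) ω) ω)ᵀ)
          (U₀ ω)) →
        ENNReal.ofReal (1 - Real.exp (-(c * ((n : ℝ) + q)))) ≤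
          gaussianMatrices q m n {ω | SD Ustar (U₀ ω) ≤ δ₀} := by
  obtain ⟨c₁, hc₁, hi₁⟩ := exists_lintegral_exp_neg_le (h := fun z => z ^ 2) (by fun_prop)
    (fun z => sq_nonneg z) one_pos fun z hz => pow_pos hz.1 2
  obtain ⟨c₂, hc₂, hi₂⟩ := exists_lintegral_exp_neg_le
    (h := fun z => z ^ 2 * (if z ^ 2 ≤ c₁ then 1 else 0))
    (Measurable.mul (by fun_prop) (Measurable.ite (measurableSet_le (by fun_prop) measurable_const)
      measurable_const measurable_const))
    (fun z => mul_nonneg (sq_nonneg z) (by split_ifs <;> norm_num))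
    (Real.sqrt_pos.mpr hc₁) fun z hz => by
      have h : z ^ 2 ≤ c₁ := by
        rw [← Real.sq_sqrt hc₁.le]
        exact pow_le_pow_left₀ hz.1.le hz.2.le 2
      simpa only [if_pos h, mul_one] using pow_pos hz.1 2
  have hCpos : (0 : ℝ) < 5 * 73728 / c₂ ^ 2 + 8 / c₁ + 8 / c₂ + 6 := by positivity
  refine ⟨1, 5 * 73728 / c₂ ^ 2 + 8 / c₁ + 8 / c₂ + 6, one_pos, hCpos, ?_⟩
  set C : ℝ := 5 * 73728 / c₂ ^ 2 + 8 / c₁ + 8 / c₂ + 6 with hC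
  intro n q r m Us B μ δ σp σm κ hUs hrank hσp hσm hκ hμ hinc hδ0 hδ1 hmq U₀ hU₀ htop
  rcases Nat.eq_zero_or_pos r with rfl | hr
  · have : {ω | SD Us (U₀ ω) ≤ δ} = Set.univ := by
      ext ω
      simp [SD, frob, hδ0.le]
    rw [this, measure_univ]
    exact ENNReal.ofReal_le_one.mpr (by linarith [Real.exp_pos (-(1 * ((n : ℝ) + q)))])
  have hn : 0 < n := by
    rcases Nat.eq_zero_or_pos n with rfl | hn
    · have := congrFun (congrFun hUs ⟨0, hr⟩) ⟨0, hr⟩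
      simp [mul_apply] at this
    · exact hn
  have hσ : 0 < σm := hσm ▸ sigMin_pos hr hrank
  have hB : ∀ w, σm * vnorm w ≤ vnorm (Bᵀ *ᵥ w) := fun w => hσm ▸ sigMin_mul_vnorm_le B w
  have hσpκ : κ * σm = σp := by rw [hκ]; field_simp
  have hB' : ∀ w, vnorm (Bᵀ *ᵥ w) ≤ κ * σm * vnorm w := fun w => by
    rw [hσpκ, hσp]; exact vnorm_transpose_mulVec_le_spec hUs B w
  have hκ1 : 1 ≤ κ := by
    have h := (hB (Pi.single ⟨0, hr⟩ 1)).trans (hB' _)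
    rw [vnorm_single_one, mul_one, mul_one] at h
    exact le_of_mul_le_mul_right (by linarith) hσ
  have hmq0 : (0 : ℝ) < m * q := by
    refine lt_of_lt_of_le ?_ hmq
    positivity
  have hm : 0 < m := Nat.pos_of_ne_zero (by rintro rfl; simp at hmq0)
  have hq : 0 < q := Nat.pos_of_ne_zero (by rintro rfl; simp at hmq0)
  have hM : ∀ k, vnorm (matCol B k) ^ 2 ≤ μ ^ 2 * (κ * σm) ^ 2 * (r / q) := fun k => by
    have h := pow_le_pow_left₀ (vnorm_nonneg _) (hinc k) 2
    rwa [mul_pow, mul_pow, Real.sq_sqrt (by positivity), ← hσpκ] at h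
  have hCa : 0 < 5 * 73728 / c₂ ^ 2 := by positivity
  have hCb : 0 < 8 / c₁ := by positivity
  have hCc : 0 < 8 / c₂ := by positivity
  have key := measure_compl_SD_le (C := C) hr hn hq hm hUs hκ1 hμ hσ hc₁ hc₂ hδ0
    (by norm_num at hδ1; linarith) hi₁ hi₂ hB hB' hM (by linarith)
    (by
      have : c₁ * (8 / c₁) = 8 := by field_simp
      rw [← this]; gcongr; linarith)
    (by
      have : c₂ * (8 / c₂) = 8 := by field_simp
      rw [← this]; gcongr; linarith)
    (by
      have : c₂ ^ 2 * (5 * 73728 / c₂ ^ 2) = 5 * 73728 := by field_simp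
      rw [← this]; gcongr; linarith) hmq hU₀ htop
  set s : ℝ := (n : ℝ) + q with hs
  have hs2 : 2 ≤ s := by
    have h1 : (1 : ℝ) ≤ n := by exact_mod_cast hn
    have h2 : (1 : ℝ) ≤ q := by exact_mod_cast hq
    linarith
  have hfour : (4 : ℝ≥0∞) * ENNReal.ofReal (Real.exp (-(3 * s))) ≤
      ENNReal.ofReal (Real.exp (-(1 * s))) := by
    have h4 : (4 : ℝ≥0∞) = ENNReal.ofReal 4 := by simp
    rw [h4, ← ENNReal.ofReal_mul (by norm_num)]
    refine ENNReal.ofReal_le_ofReal ?_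
    have e : Real.exp (-(1 * s)) = Real.exp (2 * s) * Real.exp (-(3 * s)) := by
      rw [← Real.exp_add]; ring_nf
    rw [e]
    have := Real.add_one_le_exp (2 * s)
    gcongr
    linarith
  have hmeas : MeasurableSet {ω | SD Us (U₀ ω) ≤ δ} :=
    measurableSet_le (measurable_SD Us hU₀) measurable_const
  rw [prob_compl_eq_one_sub hmeas] at key
  rw [ENNReal.ofReal_sub _ (Real.exp_pos _).le, ENNReal.ofReal_one, tsub_le_iff_right]
  rw [tsub_le_iff_right] at key
  rw [add_comm]
  exact key.trans (add_le_add_left hfour _)
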